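/- Assume the generality assumption, and suppose Γ = Z_A ∩ Z_B is finite, consisting of r ≤ 6 distinct points. Then these r points are linearly independent in P(⋀²V), i.e., representative vectors in ⋀²V of the r points are linearly independent. -/

import Mathlib

/-!
Common setup (k algebraically closed, `V = k⁵`, matrices `A₁` (2×4) and `B₁` (3×2) with
entries in `V`):

* A dual vector is represented by `φ : Fin 5 → k`, acting on `v : V` by `Σ l, φ l * v l`;
  `rankOneLocus A` is the (affine cone, minus 0, over the) locus in `P(V*)` where the
  matrix `A` has rank 1.
* `C_A` is a smooth rational normal quartic curve iff its cone is the image of the cone over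
  the standard quartic `(s:t) ↦ (s⁴, s³t, s²t², st³, t⁴)` under a linear automorphism;
  similarly `S_B` is a (smooth) rational cubic surface scroll iff its cone is the image of
  the cone over the standard scroll `S(1,2)`, `(a,b;s:t) ↦ (as, at, bs², bst, bt²)`.
  (Over an algebraically closed field the parametrized sets are the full affine cones.)
* `V_A` is the span of the 4 columns of `A₁` in `V ⊕ V`, `V_B` the span of the 3 rows of
  `B₁`; the double (Veronese) embeddings into `P(⋀²V)` have as affine cones the sets
  `coneZ V_A`, `coneZ V_B` of wedges `v₁ ∧ v₂` with `(v₁,v₂)` in `V_A` resp. `V_B`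
  (computed in the exterior algebra).  `gammaSet` is the set `Z_A ∩ Z_B` of common points,
  a subset of the projectivization of the exterior algebra.
-/

open ExteriorAlgebra

/-- The affine cone over the standard rational normal quartic curve. -/
def coneQuartic (k : Type*) [Field k] : Set (Fin 5 → k) :=
  {w | ∃ s t : k, w = ![s ^ 4, s ^ 3 * t, s ^ 2 * t ^ 2, s * t ^ 3, t ^ 4]}

/-- The affine cone over the standard smooth rational cubic surface scroll `S(1,2)`. -/
def coneScroll (k : Type*) [Field k] : Set (Fin 5 → k) :=
  {w | ∃ a b s t : k, w = ![a * s, a * t, b * s ^ 2, b * s * t, b * t ^ 2]}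

/-- The rank-one locus in `P(V*)` (as an affine cone minus the origin) of a matrix with
entries in `V = k⁵`. -/
def rankOneLocus {k : Type*} [Field k] {m n : ℕ}
    (A : Matrix (Fin m) (Fin n) (Fin 5 → k)) : Set (Fin 5 → k) :=
  {φ | (Matrix.of fun i j => ∑ l, φ l * A i j l).rank = 1}

/-- `C_A` is a smooth rational normal quartic curve. -/
def IsRNQuartic {k : Type*} [Field k] {m n : ℕ}
    (A : Matrix (Fin m) (Fin n) (Fin 5 → k)) : Prop :=
  ∃ g : (Fin 5 → k) ≃ₗ[k] (Fin 5 → k), rankOneLocus A ∪ {0} = g '' coneQuartic k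

/-- `S_B` is a smooth rational cubic surface scroll. -/
def IsCubicScroll {k : Type*} [Field k] {m n : ℕ}
    (B : Matrix (Fin m) (Fin n) (Fin 5 → k)) : Prop :=
  ∃ g : (Fin 5 → k) ≃ₗ[k] (Fin 5 → k), rankOneLocus B ∪ {0} = g '' coneScroll k

/-- The span of the columns of `A₁` in `V ⊕ V`. -/
def colSpace {k : Type*} [Field k]
    (A₁ : Matrix (Fin 2) (Fin 4) (Fin 5 → k)) : Submodule k ((Fin 5 → k) × (Fin 5 → k)) :=
  Submodule.span k (Set.range fun j => (A₁ 0 j, A₁ 1 j))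

/-- The span of the rows of `B₁` in `V ⊕ V`. -/
def rowSpace {k : Type*} [Field k]
    (B₁ : Matrix (Fin 3) (Fin 2) (Fin 5 → k)) : Submodule k ((Fin 5 → k) × (Fin 5 → k)) :=
  Submodule.span k (Set.range fun i => (B₁ i 0, B₁ i 1))

/-- The affine cone (inside the exterior algebra) over the image `Z_W ⊆ P(⋀²V)` of `P(W)`
under the double (quadratic Veronese) embedding `(v₁,v₂) ↦ v₁ ∧ v₂`. -/
def coneZ {k : Type*} [Field k] (W : Submodule k ((Fin 5 → k) × (Fin 5 → k))) :
    Set (ExteriorAlgebra k (Fin 5 → k)) :=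
  {ω | ∃ p ∈ W, ω = ι k p.1 * ι k p.2}

/-- The set `Γ = Z_A ∩ Z_B` of common points, inside the projectivization. -/
def gammaSet {k : Type*} [Field k]
    (A₁ : Matrix (Fin 2) (Fin 4) (Fin 5 → k)) (B₁ : Matrix (Fin 3) (Fin 2) (Fin 5 → k)) :
    Set (Projectivization k (ExteriorAlgebra k (Fin 5 → k))) :=
  {z | ∃ (ω : ExteriorAlgebra k (Fin 5 → k)) (hω : ω ≠ 0),
    z = Projectivization.mk k ω hω ∧ ω ∈ coneZ (colSpace A₁) ∩ coneZ (rowSpace B₁)}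


lemma rank_one_minor {k : Type*} [Field k] {m n : ℕ} (M : Matrix (Fin m) (Fin n) k)
    (h : M.rank = 1) (i i' : Fin m) (j j' : Fin n) : M i j * M i' j' = M i j' * M i' j := by
  have h1 : (M.submatrix ![i, i'] ![j, j']).rank ≤ 1 := by
    rw [← h]; exact Matrix.rank_submatrix_le _ _ _
  by_contra hne
  have hdet : IsUnit (M.submatrix ![i, i'] ![j, j']) := by
    rw [Matrix.isUnit_iff_isUnit_det, isUnit_iff_ne_zero, Matrix.det_fin_two]
    simpa using sub_ne_zero.2 hne
  have := Matrix.rank_of_isUnit _ hdet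
  rw [Fintype.card_fin] at this
  omega

lemma rank_one_of_vecMulVec {k : Type*} [Field k] {m n : ℕ} (M : Matrix (Fin m) (Fin n) k)
    (u : Fin m → k) (w : Fin n → k) (h : ∀ i j, M i j = u i * w j) (i : Fin m) (j : Fin n)
    (hne : M i j ≠ 0) : M.rank = 1 := by
  have e : M = Matrix.vecMulVec u w := by
    ext i j; simp [Matrix.vecMulVec, h]
  apply le_antisymm
  · rw [e]; exact Matrix.rank_vecMulVec_le _ _
  · rw [Nat.one_le_iff_ne_zero]
    intro h0
    rw [Matrix.rank, Module.finrank_eq_zero_iff_of_free, Submodule.subsingleton_iff_eq_bot,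
      LinearMap.range_eq_bot] at h0
    have h2 := congrFun (LinearMap.congr_fun h0 (Pi.single j 1)) i
    simp at h2
    exact hne h2

lemma exists_kappa {k : Type*} [Field k] (g : (Fin 5 → k) ≃ₗ[k] (Fin 5 → k)) :
    ∃ κ : (Fin 5 → k) ≃ₗ[k] (Fin 5 → k), ∀ y v, ∑ l, g y l * v l = ∑ n, y n * κ v n := by
  let κ0 : (Fin 5 → k) →ₗ[k] (Fin 5 → k) := (LinearMap.toMatrix' g.toLinearMap).transpose.toLin'
  have key : ∀ y v, ∑ l, g y l * v l = ∑ n, y n * κ0 v n := by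
    intro y v
    have : g y = (LinearMap.toMatrix' g.toLinearMap).mulVec y := by
      rw [← Matrix.toLin'_apply]; simp
    change g y ⬝ᵥ v = y ⬝ᵥ κ0 v
    rw [this]
    simp only [κ0, Matrix.toLin'_apply]
    rw [Matrix.mulVec_transpose, dotProduct_comm, Matrix.dotProduct_mulVec, dotProduct_comm]
  have inj : Function.Injective κ0 := by
    rw [← LinearMap.ker_eq_bot, LinearMap.ker_eq_bot']
    intro v hv
    funext i
    have := key (g.symm (Pi.single i 1)) v
    simpa [hv, Pi.single_apply] using this
  exact ⟨LinearEquiv.ofInjectiveEndo κ0 inj, fun y v => by simpa using key y v⟩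

lemma exists_plucker {k V : Type*} [Field k] [AddCommGroup V] [Module k V]
    (φ ψ : V →ₗ[k] k) :
    ∃ P : ExteriorAlgebra k V →ₗ[k] k, ∀ v w, P (ι k v * ι k w) = φ v * ψ w - φ w * ψ v := by
  let D : V [⋀^Fin 2]→ₗ[k] k :=
    (Matrix.detRowAlternating (n := Fin 2) (R := k)).compLinearMap (LinearMap.pi ![φ, ψ])
  refine ⟨liftAlternating (Pi.single 2 D), fun v w => ?_⟩
  have e : ι k v * ι k w = ιMulti k 2 ![v, w] := by
    simp [ιMulti_apply]
  rw [e, liftAlternating_apply_ιMulti]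
  simp [D]
  change Matrix.det (Matrix.of fun i j => (LinearMap.pi ![φ, ψ]) (![v, w] i) j) = _
  rw [Matrix.det_fin_two]
  simp
  ring

lemma wedge_expand {k V : Type*} [Field k] [AddCommGroup V] [Module k V]
    (E : (Fin 5 → k) →ₗ[k] V) :
    ∃ R : (Fin 5 → Fin 5 → k) → ExteriorAlgebra k V, ∀ x y : Fin 5 → k,
      ι k (E x) * ι k (E y) = R (fun i j => x i * y j - x j * y i) := by
  let b : Fin 5 → ExteriorAlgebra k V := fun i => ι k (E (Pi.single i 1))
  have hx : ∀ x : Fin 5 → k, ι k (E x) = ∑ i, x i • b i := by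
    intro x
    conv_lhs => rw [← Finset.univ_sum_single x]
    simp only [map_sum]
    refine Finset.sum_congr rfl fun i _ => ?_
    have : (Pi.single i (x i) : Fin 5 → k) = x i • Pi.single i 1 := by
      simp [← Pi.single_smul]
    simp [b, this]
  have hsq : ∀ i, b i * b i = 0 := fun i => ι_sq_zero _
  have hanti : ∀ i j, b i * b j = - (b j * b i) := fun i j =>
    eq_neg_of_add_eq_zero_left (ι_add_mul_swap _ _)
  refine ⟨fun p => p 0 1 • (b 0 * b 1) + p 0 2 • (b 0 * b 2) + p 0 3 • (b 0 * b 3)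
    + p 0 4 • (b 0 * b 4) + p 1 2 • (b 1 * b 2) + p 1 3 • (b 1 * b 3) + p 1 4 • (b 1 * b 4)
    + p 2 3 • (b 2 * b 3) + p 2 4 • (b 2 * b 4) + p 3 4 • (b 3 * b 4), fun x y => ?_⟩
  rw [hx, hx]
  simp only [Fin.sum_univ_five, add_mul, mul_add, smul_mul_smul_comm, hsq]
  rw [hanti 1 0, hanti 2 0, hanti 3 0, hanti 4 0, hanti 2 1, hanti 3 1, hanti 4 1, hanti 3 2,
    hanti 4 2, hanti 4 3]
  module

lemma rank_one_factor {R ι' : Type*} [CommRing R] [IsDomain R] [UniqueFactorizationMonoid R]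
    (f h : ι' → R) (hm : ∀ i j, f i * h j = f j * h i) (i₀ : ι') (h0 : f i₀ ≠ 0 ∨ h i₀ ≠ 0) :
    ∃ (p q : R) (w : ι' → R), IsRelPrime p q ∧ ∀ i, f i = w i * p ∧ h i = w i * q := by
  have main : ∀ (f h : ι' → R), (∀ i j, f i * h j = f j * h i) → h i₀ ≠ 0 → 
      ∃ (p q : R) (w : ι' → R), IsRelPrime p q ∧ ∀ i, f i = w i * p ∧ h i = w i * q := by
    intro f h hm h0
    obtain ⟨p, q, c, hrel, hp, hq⟩ := UniqueFactorizationMonoid.exists_reduced_factors' (f i₀) _ h0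
    have hc : c ≠ 0 := by rintro rfl; simp at hq; exact h0 hq.symm
    have hq0 : q ≠ 0 := by rintro rfl; simp at hq; exact h0 hq.symm
    have h1 : ∀ i, f i * q = p * h i := fun i => by
      have := hm i i₀
      rw [← hp, ← hq] at this
      apply mul_left_cancel₀ hc
      linear_combination this
    have h2 : ∀ i, q ∣ h i := fun i =>
      hrel.symm.dvd_of_dvd_mul_left (Dvd.intro_left _ (h1 i))
    choose w hw using h2
    refine ⟨p, q, w, hrel, fun i => ⟨?_, by rw [hw, mul_comm]⟩⟩
    apply mul_right_cancel₀ hq0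
    rw [h1, hw]; ring
  rcases h0 with h0 | h0
  · obtain ⟨p, q, w, hr, hw⟩ := main h f (fun i j => by linear_combination -hm i j) h0
    exact ⟨q, p, w, hr.symm, fun i => (hw i).symm⟩
  · exact main f h hm h0

lemma exists_sqrt {k : Type*} [Field k] [IsAlgClosed k] (x : k) : ∃ z, z * z = x :=
  let ⟨z, hz⟩ := IsAlgClosed.exists_eq_mul_self x; ⟨z, hz.symm⟩

/-- binary quadratic forms have nontrivial zeros -/
lemma exists_binary_zero {k : Type*} [Field k] [IsAlgClosed k] (a b c : k) :
    ∃ s t : k, (s ≠ 0 ∨ t ≠ 0) ∧ a * s ^ 2 + b * (s * t) + c * t ^ 2 = 0 := by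
  by_cases ha : a = 0
  · exact ⟨1, 0, by simp, by simp [ha]⟩
  · obtain ⟨x, hx⟩ := IsAlgClosed.exists_root
      (Polynomial.C a * Polynomial.X ^ 2 + Polynomial.C b * Polynomial.X + Polynomial.C c)
      (by rw [Polynomial.degree_quadratic ha]; norm_num)
    refine ⟨x, 1, by simp, ?_⟩
    simpa [Polynomial.IsRoot] using hx

section PolyPart
open Polynomial

lemma card_le_of_range {k W : Type*} [Field k] [AddCommGroup W] [Module k W] {m n : ℕ}
    (v : Fin m → W) (hv : LinearIndependent k v) (L : (Fin n → k) →ₗ[k] W)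
    (h : ∀ j, v j ∈ LinearMap.range L) : m ≤ n := by
  have h1 : LinearIndependent k (fun j => (⟨v j, h j⟩ : LinearMap.range L)) :=
    LinearIndependent.of_comp (LinearMap.range L).subtype (by simpa [Function.comp_def] using hv)
  have h2 := h1.fintype_card_le_finrank
  have h3 := LinearMap.finrank_range_le L
  simp at h2 h3
  omega

lemma delta_ne {k : Type*} [Field k] (p q : k[X]) (hp : p.natDegree = 1) (hq : q.natDegree ≤ 1)
    (hr : IsRelPrime p q) : p.coeff 0 * q.coeff 1 - p.coeff 1 * q.coeff 0 ≠ 0 := by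
  intro h
  have hp1 : p.coeff 1 ≠ 0 := by
    have : p ≠ 0 := by rintro rfl; simp at hp
    have := leadingCoeff_ne_zero.2 this
    rwa [leadingCoeff, hp] at this
  have e : q = p * C (q.coeff 1 / p.coeff 1) := by
    rw [eq_X_add_C_of_natDegree_le_one hq, eq_X_add_C_of_natDegree_le_one hp.le]
    ext n
    rcases n with _ | _ | n
    · simp; field_simp; linear_combination -h
    · simp; field_simp
    · simp [coeff_X, coeff_C]
  have hu : IsUnit p := hr dvd_rfl ⟨_, e⟩
  have := natDegree_eq_zero_of_isUnit hu
  omega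

/-- polynomial attached to a coefficient vector -/
noncomputable def toP (k : Type*) [Field k] : (Fin 5 → k) →ₗ[k] k[X] :=
  ∑ n : Fin 5, (monomial (n : ℕ)).comp (LinearMap.proj n)

lemma toP_apply {k : Type*} [Field k] (v : Fin 5 → k) :
    toP k v = C (v 0) + C (v 1) * X + C (v 2) * X ^ 2 + C (v 3) * X ^ 3 + C (v 4) * X ^ 4 := by
  simp [toP, Fin.sum_univ_five, ← C_mul_X_pow_eq_monomial]

lemma toP_coeff {k : Type*} [Field k] (v : Fin 5 → k) (n : Fin 5) : (toP k v).coeff n = v n := by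
  rw [toP_apply]
  fin_cases n <;> simp [coeff_X, coeff_C]

lemma toP_natDegree {k : Type*} [Field k] (v : Fin 5 → k) : (toP k v).natDegree ≤ 4 := by
  rw [toP_apply]; compute_degree

lemma toP_inj {k : Type*} [Field k] : Function.Injective (toP k) := fun v w h => by
  funext n; rw [← toP_coeff v, h, toP_coeff]

lemma e_not_quartic {k : Type*} [Field k] :
    Pi.single 1 1 ∉ coneQuartic k ∧ Pi.single 2 1 ∉ coneQuartic k := by
  constructor
  · rintro ⟨s, t, h⟩
    have h0 := congrFun h 0
    have h1 := congrFun h 1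
    have hs : s = 0 := by simpa using h0.symm
    simp [hs] at h1
  · rintro ⟨s, t, h⟩
    have h0 := congrFun h 0
    have h1 := congrFun h 2
    have hs : s = 0 := by simpa using h0.symm
    simp [hs] at h1

lemma natDegree_left_le {R : Type*} [CommRing R] [IsDomain R] {w p : R[X]} {n d : ℕ}
    (hp : p ≠ 0) (h : (w * p).natDegree ≤ n) (hd : n ≤ d + p.natDegree) : w.natDegree ≤ d := by
  by_cases hw : w = 0
  · simp [hw]
  · rw [natDegree_mul hw hp] at h; omega

lemma normalA {k : Type*} [Field k] [Infinite k] (M : Fin 2 → Fin 4 → Fin 5 → k)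
    (hM : ∀ y, ((Matrix.of fun i j => ∑ n, y n * M i j n).rank = 1 ∨ y = 0) ↔ y ∈ coneQuartic k)
    (hind : LinearIndependent k (fun j => (M 0 j, M 1 j))) :
    ∃ p0 p1 q0 q1 : k, p0 * q1 - p1 * q0 ≠ 0 ∧ ∃ N : (Fin 4 → k) ≃ₗ[k] (Fin 4 → k), ∀ x,
      ∑ j, x j • M 0 j = p0 • ![N x 0, N x 1, N x 2, N x 3, 0] + p1 • ![0, N x 0, N x 1, N x 2, N x 3]
    ∧ ∑ j, x j • M 1 j = q0 • ![N x 0, N x 1, N x 2, N x 3, 0] + q1 • ![0, N x 0, N x 1, N x 2, N x 3]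
    := by
  have hminor : ∀ i j, toP k (M 0 i) * toP k (M 1 j) = toP k (M 0 j) * toP k (M 1 i) := by
    intro i j
    apply Polynomial.funext
    intro x
    have hy := (hM ![1, x, x ^ 2, x ^ 3, x ^ 4]).2 ⟨1, x, by simp⟩
    rcases hy with hy | hy
    · have := rank_one_minor _ hy 0 1 i j
      simp [Fin.sum_univ_five] at this
      simp [toP_apply]
      linear_combination this
    · exact absurd (congrFun hy 0) (by simp)
  have hne : ∀ j, (M 0 j, M 1 j) ≠ 0 := fun j => hind.ne_zero j
  obtain ⟨p, q, w, hrel, hw⟩ := rank_one_factor (fun j => toP k (M 0 j)) (fun j => toP k (M 1 j))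
    hminor 0 (by
      by_contra! h
      apply hne 0
      have h1 := toP_inj (h.1.trans (map_zero _).symm)
      have h2 := toP_inj (h.2.trans (map_zero _).symm)
      rw [h1, h2]; rfl)
  have hwind : LinearIndependent k w := by
    rw [Fintype.linearIndependent_iff] at hind ⊢
    intro x hx
    apply hind
    rw [Prod.ext_iff]
    simp only [Prod.fst_sum, Prod.snd_sum, Prod.smul_fst, Prod.smul_snd, Prod.fst_zero, Prod.snd_zero]
    constructor <;> apply toP_inj <;> simp only [map_sum, map_smul, map_zero]
    · simp only [(hw _).1, ← smul_mul_assoc, ← Finset.sum_mul, hx, zero_mul]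
    · simp only [(hw _).2, ← smul_mul_assoc, ← Finset.sum_mul, hx, zero_mul]
  have hdeg : ∀ d, (∀ j, (w j).natDegree ≤ d) → 3 ≤ d := by
    intro d h
    have := card_le_of_range (n := d + 1) w hwind
      (∑ n : Fin (d + 1), (monomial (n : ℕ)).comp (LinearMap.proj n)) (fun j =>
        ⟨fun n => (w j).coeff n, by
          simp
          rw [Fin.sum_univ_eq_sum_range (fun n => monomial n ((w j).coeff n))]
          exact ((w j).as_sum_range' (d + 1) (by have := h j; omega)).symm⟩)
    omega
  have hdp : ∀ j, (w j * p).natDegree ≤ 4 := fun j => by rw [← (hw j).1]; exact toP_natDegree _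
  have hdq : ∀ j, (w j * q).natDegree ≤ 4 := fun j => by rw [← (hw j).2]; exact toP_natDegree _
  have hp1 : p.natDegree ≤ 1 := by
    by_contra! h
    have hp : p ≠ 0 := by rintro rfl; simp at h
    have := hdeg 2 (fun j => natDegree_left_le hp (hdp j) (by omega))
    omega
  have hq1 : q.natDegree ≤ 1 := by
    by_contra! h
    have hp : q ≠ 0 := by rintro rfl; simp at h
    have := hdeg 2 (fun j => natDegree_left_le hp (hdq j) (by omega))
    omega
  have hnc : p.natDegree = 1 ∨ q.natDegree = 1 := by
    by_contra! h
    have hp0 : p.natDegree = 0 := by omega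
    have hq0 : q.natDegree = 0 := by omega
    have e0 : ∀ j n, M 0 j n = p.coeff 0 * (w j).coeff n := fun j n => by
      rw [← toP_coeff (M 0 j), (hw j).1, eq_C_of_natDegree_eq_zero hp0]; simp [mul_comm]
    have e1 : ∀ j n, M 1 j n = q.coeff 0 * (w j).coeff n := fun j n => by
      rw [← toP_coeff (M 1 j), (hw j).2, eq_C_of_natDegree_eq_zero hq0]; simp [mul_comm]
    have hker : ∀ y ∉ coneQuartic k, ∀ i j, ∑ n, y n * M i j n = 0 := by
      intro y hy i j
      by_contra hne
      apply hy
      rw [← hM]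
      left
      refine rank_one_of_vecMulVec _ ![p.coeff 0, q.coeff 0] (fun j => ∑ n, y n * (w j).coeff n)
        ?_ i j hne
      intro i j
      fin_cases i <;> simp [e0, e1, Finset.mul_sum] <;> 
        exact Finset.sum_congr rfl fun _ _ => by ring
    have k1 := hker _ e_not_quartic.1
    have k2 := hker _ e_not_quartic.2
    simp [Pi.single_apply] at k1 k2
    let L0 : (Fin 3 → k) →ₗ[k] (Fin 5 → k) :=
      LinearMap.pi ![LinearMap.proj 0, 0, 0, LinearMap.proj 1, LinearMap.proj 2]
    have := card_le_of_range (n := 3) _ hind ((p.coeff 0 • L0).prod (q.coeff 0 • L0)) (fun j =>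
        ⟨![(w j).coeff 0, (w j).coeff 3, (w j).coeff 4], by
          ext n
          · fin_cases n <;> simp [L0, k1, k2, e0]
          · fin_cases n <;> simp [L0, k1, k2, e1]⟩)
    omega
  have hw3 : ∀ j, (w j).natDegree ≤ 3 := by
    intro j
    rcases hnc with h | h
    · exact natDegree_left_le (by rintro rfl; simp at h) (hdp j) (by omega)
    · exact natDegree_left_le (by rintro rfl; simp at h) (hdq j) (by omega)
  have hδ : p.coeff 0 * q.coeff 1 - p.coeff 1 * q.coeff 0 ≠ 0 := by
    rcases hnc with h | h
    · exact delta_ne p q h hq1 hrel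
    · have := delta_ne q p h hp1 hrel.symm
      intro h0; apply this; linear_combination -h0
  let N0 : (Fin 4 → k) →ₗ[k] (Fin 4 → k) :=
    LinearMap.pi fun i => (lcoeff k (i : ℕ)).comp (Fintype.linearCombination k w)
  have hN0 : ∀ x i, N0 x i = ∑ j, x j * (w j).coeff i := by
    intro x i
    simp [N0, Fintype.linearCombination_apply]
  have hinj : Function.Injective N0 := by
    rw [← LinearMap.ker_eq_bot, LinearMap.ker_eq_bot']
    intro x hx
    rw [Fintype.linearIndependent_iff] at hwind
    funext j
    refine hwind x ?_ j
    ext n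
    by_cases hn : n < 4
    · have := congrFun hx ⟨n, hn⟩
      rw [hN0] at this
      simpa using this
    · simp
      refine Finset.sum_eq_zero fun j _ => ?_
      rw [coeff_eq_zero_of_natDegree_lt (by have := hw3 j; omega), mul_zero]
  have hw4 : ∀ j, (w j).coeff 4 = 0 := fun j =>
    coeff_eq_zero_of_natDegree_lt (by have := hw3 j; omega)
  have hco : ∀ (r : k[X]) (hr : r.natDegree ≤ 1) (m : Fin 4 → Fin 5 → k)
      (hm : ∀ j, toP k (m j) = w j * r) (x : Fin 4 → k), ∑ j, x j • m j =
      r.coeff 0 • ![N0 x 0, N0 x 1, N0 x 2, N0 x 3, 0] +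
        r.coeff 1 • ![0, N0 x 0, N0 x 1, N0 x 2, N0 x 3] := by
    intro r hr m hm x
    have e : ∀ j n, m j n = (w j * r).coeff n := fun j n => by rw [← hm, toP_coeff]
    have e2 : ∀ j, w j * r = w j * C (r.coeff 0) + w j * C (r.coeff 1) * X := fun j => by
      conv_lhs => rw [eq_X_add_C_of_natDegree_le_one hr]
      ring
    funext n
    fin_cases n <;> simp [hN0, e, e2, Finset.mul_sum, ← Finset.sum_add_distrib, coeff_mul_X,
        show (4 : ℕ) = 3 + 1 from rfl, show (3 : ℕ) = 2 + 1 from rfl, show (2 : ℕ) = 1 + 1 from rfl,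
        hw4]
    all_goals exact Finset.sum_congr rfl fun _ _ => by ring
  exact ⟨p.coeff 0, p.coeff 1, q.coeff 0, q.coeff 1, hδ, LinearEquiv.ofInjectiveEndo N0 hinj,
    fun x => ⟨by simpa using hco p hp1 (M 0) (fun j => (hw j).1) x,
      by simpa using hco q hq1 (M 1) (fun j => (hw j).2) x⟩⟩


/-- bivariate polynomial attached to a coefficient vector (scroll) -/
noncomputable def toB {k : Type*} [Field k] (v : Fin 5 → k) : k[X][X] :=
  C (C (v 2) + C (v 3) * X + C (v 4) * X ^ 2) + C (C (v 0) + C (v 1) * X) * X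

lemma toB_coeff_zero {k : Type*} [Field k] (v : Fin 5 → k) :
    (toB v).coeff 0 = C (v 2) + C (v 3) * X + C (v 4) * X ^ 2 := by
  simp only [toB, coeff_add, coeff_C_zero, mul_coeff_zero, coeff_X_zero, mul_zero, add_zero]

lemma toB_coeff_one {k : Type*} [Field k] (v : Fin 5 → k) :
    (toB v).coeff 1 = C (v 0) + C (v 1) * X := by
  simp only [toB, coeff_add, coeff_C_succ, coeff_mul_X, coeff_C_zero, zero_add]

lemma toB_natDegree {k : Type*} [Field k] (v : Fin 5 → k) : (toB v).natDegree ≤ 1 := by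
  unfold toB
  refine (natDegree_add_le _ _).trans (max_le ?_ ?_)
  · rw [natDegree_C]; omega
  · exact (natDegree_C_mul_le _ _).trans natDegree_X_le

lemma toB_coords {k : Type*} [Field k] (v : Fin 5 → k) :
    v = ![((toB v).coeff 1).coeff 0, ((toB v).coeff 1).coeff 1, ((toB v).coeff 0).coeff 0,
      ((toB v).coeff 0).coeff 1, ((toB v).coeff 0).coeff 2] := by
  rw [toB_coeff_zero, toB_coeff_one]
  funext n
  fin_cases n <;> simp [coeff_X, coeff_C]

lemma toB_deg0 {k : Type*} [Field k] (v : Fin 5 → k) : ((toB v).coeff 0).natDegree ≤ 2 := by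
  rw [toB_coeff_zero]; compute_degree

lemma toB_deg1 {k : Type*} [Field k] (v : Fin 5 → k) : ((toB v).coeff 1).natDegree ≤ 1 := by
  rw [toB_coeff_one]; compute_degree

lemma toB_inj {k : Type*} [Field k] {v w : Fin 5 → k} (h : toB v = toB w) : v = w := by
  rw [toB_coords v, h, ← toB_coords]

lemma e_not_scroll {k : Type*} [Field k] :
    (![0, 0, 0, 1, 0] : Fin 5 → k) ∉ coneScroll k ∧ (![1, 0, 0, 0, 1] : Fin 5 → k) ∉ coneScroll k ∧
    (![0, 1, 1, 0, 0] : Fin 5 → k) ∉ coneScroll k := by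
  refine ⟨?_, ?_, ?_⟩
  all_goals
    rintro ⟨a, b, s, t, h⟩
    have h0 := congrFun h 0
    have h1 := congrFun h 1
    have h2 := congrFun h 2
    have h3 := congrFun h 3
    have h4 := congrFun h 4
    simp only [Matrix.cons_val] at h0 h1 h2 h3 h4
  · have : (1 : k) = 0 := by linear_combination h3 * (1 + b * s * t) - h2 * b * t ^ 2
    simp at this
  · have : (1 : k) = 0 := by linear_combination h0 + a * s * h4 - a * t * h3
    simp at this
  · have : (1 : k) = 0 := by linear_combination h1 + a * t * h2 - a * s * h3
    simp at this

lemma C_dvd_C {R : Type*} [CommRing R] {a b : R} (h : a ∣ b) : (C a : R[X]) ∣ C b := by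
  obtain ⟨e, he⟩ := h
  exact ⟨C e, by rw [he, C_mul]⟩

lemma smul_CC {k : Type*} [Field k] (x : k) (f : k[X][X]) : x • f = C (C x) * f := by
  ext n m
  simp

set_option maxHeartbeats 2000000 in
lemma normalB {k : Type*} [Field k] [Infinite k] (M : Fin 3 → Fin 2 → Fin 5 → k)
    (hM : ∀ y, ((Matrix.of fun i j => ∑ n, y n * M i j n).rank = 1 ∨ y = 0) ↔ y ∈ coneScroll k)
    (hind : LinearIndependent k (fun i => (M i 0, M i 1))) :
    ∃ p0 p1 q0 q1 : k, p0 * q1 - p1 * q0 ≠ 0 ∧ ∃ N : (Fin 3 → k) ≃ₗ[k] (Fin 3 → k), ∀ x,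
      ∑ i, x i • M i 0 = p0 • ![N x 0, 0, N x 1, N x 2, 0] + p1 • ![0, N x 0, 0, N x 1, N x 2]
    ∧ ∑ i, x i • M i 1 = q0 • ![N x 0, 0, N x 1, N x 2, 0] + q1 • ![0, N x 0, 0, N x 1, N x 2]
    := by
  have hminor : ∀ i j, toB (M i 0) * toB (M j 1) = toB (M j 0) * toB (M i 1) := by
    intro i j
    apply Polynomial.eq_of_infinite_eval_eq
    refine Set.Infinite.mono (s := Set.range (C : k → k[X])) ?_ (Set.infinite_range_of_injective C_injective)
    rintro _ ⟨a, rfl⟩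
    apply Polynomial.funext
    intro x
    have hy := (hM ![a, a * x, 1, x, x ^ 2]).2 ⟨a, 1, 1, x, by simp⟩
    rcases hy with hy | hy
    · have := rank_one_minor _ hy i j 0 1
      simp [Fin.sum_univ_five] at this
      simp [toB]
      linear_combination this
    · exact absurd (congrFun hy 2) (by simp)
  have hne : ∀ j, (M j 0, M j 1) ≠ 0 := fun j => hind.ne_zero j
  have toB0 : toB (0 : Fin 5 → k) = 0 := by simp [toB]
  obtain ⟨p, q, w, hrel, hw⟩ := rank_one_factor (fun j => toB (M j 0)) (fun j => toB (M j 1))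
    hminor 0 (by
      by_contra! h
      apply hne 0
      have h1 := toB_inj (h.1.trans toB0.symm)
      have h2 := toB_inj (h.2.trans toB0.symm)
      rw [h1, h2]; rfl)
  have hsum : ∀ (x : Fin 3 → k) (m : Fin 3 → Fin 5 → k), toB (∑ j, x j • m j) = ∑ j, x j • toB (m j) := by
    intro x m
    simp only [toB, Fin.sum_univ_three, Pi.add_apply, Pi.smul_apply, smul_eq_mul,
      map_add, map_mul, smul_CC]
    ring
  have hwind : LinearIndependent k w := by
    rw [Fintype.linearIndependent_iff] at hind ⊢
    intro x hx
    apply hind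
    rw [Prod.ext_iff]
    simp only [Prod.fst_sum, Prod.snd_sum, Prod.smul_fst, Prod.smul_snd, Prod.fst_zero, Prod.snd_zero]
    constructor <;> apply toB_inj <;> rw [hsum, toB0]
    · simp only [(hw _).1, ← smul_mul_assoc, ← Finset.sum_mul, hx, zero_mul]
    · simp only [(hw _).2, ← smul_mul_assoc, ← Finset.sum_mul, hx, zero_mul]
  have hw0 : ∀ j, w j ≠ 0 := fun j => hwind.ne_zero j
  -- no `X` in `p`, `q`
  have hX : ∀ (r : k[X][X]) (m : Fin 3 → Fin 5 → k), (∀ j, toB (m j) = w j * r) → r.natDegree = 0 := by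
    intro r m hm
    by_contra hr
    have hr0 : r ≠ 0 := by rintro rfl; simp at hr
    have hd : ∀ j, (w j).natDegree + r.natDegree ≤ 1 := fun j => by
      rw [← natDegree_mul (hw0 j) hr0, ← hm]; exact toB_natDegree _
    have hr1 : r.natDegree = 1 := by have := hd 0; omega
    have hwj : ∀ j, w j = C ((w j).coeff 0) := fun j =>
      eq_C_of_natDegree_eq_zero (by have := hd j; omega)
    have hrc : r.coeff 1 ≠ 0 := by
      have := leadingCoeff_ne_zero.2 hr0
      rwa [leadingCoeff, hr1] at this
    have hu : ∀ j, ((w j).coeff 0).natDegree ≤ 1 := fun j => by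
      have h1 := toB_deg1 (m j)
      rw [hm, hwj, coeff_C_mul] at h1
      exact natDegree_left_le hrc h1 (by omega)
    have := card_le_of_range (n := 2) w hwind
      (∑ n : Fin 2, (((monomial 0).restrictScalars k).comp (monomial (n : ℕ))).comp (LinearMap.proj n)) (fun j =>
        ⟨fun n => ((w j).coeff 0).coeff n, by
          rw [hwj j]
          conv_rhs => rw [eq_X_add_C_of_natDegree_le_one (hu j)]
          simp [Fin.sum_univ_two, ← C_mul_X_pow_eq_monomial]
          ring⟩)
    omega
  have hp0 := hX p (fun j => M j 0) (fun j => (hw j).1)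
  have hq0 := hX q (fun j => M j 1) (fun j => (hw j).2)
  obtain ⟨P, rfl⟩ := natDegree_eq_zero.1 hp0
  obtain ⟨Q, rfl⟩ := natDegree_eq_zero.1 hq0
  have hrelPQ : IsRelPrime P Q := fun d h1 h2 =>
    isUnit_C.1 (hrel (C_dvd_C h1) (C_dvd_C h2))
  have hPQ : P ≠ 0 ∨ Q ≠ 0 := by
    by_contra! h
    rw [h.1, h.2] at hrelPQ
    exact not_isUnit_zero (hrelPQ dvd_rfl dvd_rfl)
  have hwlin : ∀ j, (w j).natDegree ≤ 1 := fun j => by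
    rcases hPQ with h | h
    · exact natDegree_left_le (n := 1) (p := C P) (by simpa using h) (by rw [← (hw j).1]; exact toB_natDegree _) (by omega)
    · exact natDegree_left_le (n := 1) (p := C Q) (by simpa using h) (by rw [← (hw j).2]; exact toB_natDegree _) (by omega)
  have hd0 : ∀ (r : k[X]) (m : Fin 3 → Fin 5 → k), (∀ j, toB (m j) = w j * C r) → 
      ∀ j, ((w j).coeff 0 * r).natDegree ≤ 2 ∧ ((w j).coeff 1 * r).natDegree ≤ 1 := fun r m hm j => by
    have h0 := toB_deg0 (m j)
    have h1 := toB_deg1 (m j)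
    rw [hm, coeff_mul_C] at h0 h1
    exact ⟨h0, h1⟩
  have hle : ∀ (r : k[X]) (m : Fin 3 → Fin 5 → k), (∀ j, toB (m j) = w j * C r) → r.natDegree ≤ 1 := by
    intro r m hm
    by_contra! h
    have hr : r ≠ 0 := by rintro rfl; simp at h
    have h0 : ∀ j, ((w j).coeff 0).natDegree = 0 := fun j =>
      Nat.le_zero.1 (natDegree_left_le hr (hd0 r m hm j).1 (by omega))
    have h1 : ∀ j, (w j).coeff 1 = 0 := fun j => by
      by_contra hne
      have := (hd0 r m hm j).2
      rw [natDegree_mul hne hr] at this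
      omega
    have := card_le_of_range (n := 1) w hwind
      (((monomial 0).restrictScalars k).comp (monomial 0) |>.comp (LinearMap.proj 0)) (fun j =>
        ⟨fun n => ((w j).coeff 0).coeff n, by
          conv_rhs => rw [eq_X_add_C_of_natDegree_le_one (hwlin j), h1, eq_C_of_natDegree_eq_zero (h0 j)]
          simp⟩)
    omega
  have hP1 := hle P (fun j => M j 0) (fun j => (hw j).1)
  have hQ1 := hle Q (fun j => M j 1) (fun j => (hw j).2)
  have hwe : ∀ j, w j = C ((w j).coeff 1) * X + C ((w j).coeff 0) := fun j =>
    eq_X_add_C_of_natDegree_le_one (hwlin j)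
  have hnc : P.natDegree = 1 ∨ Q.natDegree = 1 := by
    by_contra! h
    have hp0 : P.natDegree = 0 := by omega
    have hq0 : Q.natDegree = 0 := by omega
    let a : Fin 3 → Fin 5 → k := fun j => ![((w j).coeff 1).coeff 0, ((w j).coeff 1).coeff 1, 
      ((w j).coeff 0).coeff 0, ((w j).coeff 0).coeff 1, ((w j).coeff 0).coeff 2]
    have ea : ∀ (r : k[X]) (hr : r.natDegree = 0) (m : Fin 5 → k) (j) (hm : toB m = w j * C r),
        m = r.coeff 0 • a j := by
      intro r hr m j hm
      rw [eq_C_of_natDegree_eq_zero hr] at hm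
      rw [toB_coords m, hm]
      simp only [coeff_mul_C, a]
      funext n
      fin_cases n <;> simp [mul_comm]
    have e0 : ∀ j, M j 0 = P.coeff 0 • a j := fun j => ea P hp0 _ j (hw j).1
    have e1 : ∀ j, M j 1 = Q.coeff 0 • a j := fun j => ea Q hq0 _ j (hw j).2
    have hPQ0 : P.coeff 0 ≠ 0 ∨ Q.coeff 0 ≠ 0 := by
      rw [eq_C_of_natDegree_eq_zero hp0, eq_C_of_natDegree_eq_zero hq0] at hPQ
      simpa using hPQ
    have hker : ∀ y ∉ coneScroll k, ∀ j, ∑ n, y n * a j n = 0 := by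
      intro y hy j
      by_contra hne
      apply hy
      rw [← hM]
      left
      have hform : ∀ i l, (Matrix.of fun i j => ∑ n, y n * M i j n) i l =
          (fun j => ∑ n, y n * a j n) i * (![P.coeff 0, Q.coeff 0] : Fin 2 → k) l := by
        intro i l
        fin_cases l <;> simp [e0, e1, Finset.sum_mul] <;>
          exact Finset.sum_congr rfl fun _ _ => by ring
      rcases hPQ0 with h | h
      · exact rank_one_of_vecMulVec _ _ _ hform j 0 (by rw [hform]; exact mul_ne_zero hne (by simpa using h))
      · exact rank_one_of_vecMulVec _ _ _ hform j 1 (by rw [hform]; exact mul_ne_zero hne (by simpa using h))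
    have k1 := hker _ e_not_scroll.1
    have k2 := hker _ e_not_scroll.2.1
    have k3 := hker _ e_not_scroll.2.2
    simp [Fin.sum_univ_five] at k1 k2 k3
    let L0 : (Fin 2 → k) →ₗ[k] (Fin 5 → k) :=
      LinearMap.pi ![LinearMap.proj 0, LinearMap.proj 1, -LinearMap.proj 1, 0, -LinearMap.proj 0]
    have := card_le_of_range (n := 2) _ hind ((P.coeff 0 • L0).prod (Q.coeff 0 • L0)) (fun j =>
        ⟨![a j 0, a j 1], by
          have h4 : a j 4 = - a j 0 := by linear_combination k2 j
          have h2 : a j 2 = - a j 1 := by linear_combination k3 j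
          ext n
          · fin_cases n <;> simp [L0, k1, h4, h2, e0]
          · fin_cases n <;> simp [L0, k1, h4, h2, e1]⟩)
    omega
  have hδ : P.coeff 0 * Q.coeff 1 - P.coeff 1 * Q.coeff 0 ≠ 0 := by
    rcases hnc with h | h
    · exact delta_ne P Q h hQ1 hrelPQ
    · have := delta_ne Q P h hP1 hrelPQ.symm
      intro h0; apply this; linear_combination -h0
  have hwd : ∀ j, ((w j).coeff 0).natDegree ≤ 1 ∧ ((w j).coeff 1).natDegree ≤ 0 := by
    intro j
    rcases hnc with h | h
    · have hr : P ≠ 0 := by rintro rfl; simp at h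
      have := hd0 P (fun j => M j 0) (fun j => (hw j).1) j
      exact ⟨natDegree_left_le hr this.1 (by omega), natDegree_left_le hr this.2 (by omega)⟩
    · have hr : Q ≠ 0 := by rintro rfl; simp at h
      have := hd0 Q (fun j => M j 1) (fun j => (hw j).2) j
      exact ⟨natDegree_left_le hr this.1 (by omega), natDegree_left_le hr this.2 (by omega)⟩
  have hw' : ∀ j, w j = C (C (((w j).coeff 1).coeff 0)) * X +
      C (C (((w j).coeff 0).coeff 1) * X + C (((w j).coeff 0).coeff 0)) := fun j => by
    conv_lhs => rw [hwe j, eq_X_add_C_of_natDegree_le_one (hwd j).1,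
      eq_C_of_natDegree_le_zero (hwd j).2]
  let N0 : (Fin 3 → k) →ₗ[k] (Fin 3 → k) := (Matrix.of fun i j => 
    (![((w j).coeff 1).coeff 0, ((w j).coeff 0).coeff 0, ((w j).coeff 0).coeff 1] : Fin 3 → k) i).toLin'
  have hN0 : ∀ x, N0 x = ![∑ j, x j * ((w j).coeff 1).coeff 0, ∑ j, x j * ((w j).coeff 0).coeff 0,
      ∑ j, x j * ((w j).coeff 0).coeff 1] := by
    intro x
    funext i
    fin_cases i <;> simp [N0, Matrix.mulVec, dotProduct, mul_comm]
  have hinj : Function.Injective N0 := by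
    rw [← LinearMap.ker_eq_bot, LinearMap.ker_eq_bot']
    intro x hx
    rw [Fintype.linearIndependent_iff] at hwind
    funext j
    refine hwind x ?_ j
    rw [hN0] at hx
    have x0 := congrArg (fun z => (C (C z) : k[X][X])) (congrFun hx 0)
    have x1 := congrArg (fun z => (C (C z) : k[X][X])) (congrFun hx 1)
    have x2 := congrArg (fun z => (C (C z) : k[X][X])) (congrFun hx 2)
    simp [Fin.sum_univ_three] at x0 x1 x2
    rw [Fin.sum_univ_three, hw' 0, hw' 1, hw' 2]
    simp only [smul_CC, map_add, map_mul]
    linear_combination X * x0 + x1 + C X * x2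
  have hco : ∀ (r : k[X]) (hr : r.natDegree ≤ 1) (m : Fin 3 → Fin 5 → k)
      (hm : ∀ j, toB (m j) = w j * C r) (x : Fin 3 → k), ∑ j, x j • m j =
      r.coeff 0 • ![N0 x 0, 0, N0 x 1, N0 x 2, 0] +
        r.coeff 1 • ![0, N0 x 0, 0, N0 x 1, N0 x 2] := by
    intro r hr m hm x
    have hm' : ∀ j, m j = r.coeff 0 • ![((w j).coeff 1).coeff 0, 0, ((w j).coeff 0).coeff 0, ((w j).coeff 0).coeff 1, 0] + r.coeff 1 • ![0, ((w j).coeff 1).coeff 0, 0, ((w j).coeff 0).coeff 0, ((w j).coeff 0).coeff 1] := by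
      intro j
      apply toB_inj
      rw [hm]
      conv_lhs => rw [hw' j, eq_X_add_C_of_natDegree_le_one hr]
      simp [toB]
      ring
    rw [hN0]
    simp only [hm', Fin.sum_univ_three]
    funext n
    fin_cases n <;> simp <;> ring
  exact ⟨P.coeff 0, P.coeff 1, Q.coeff 0, Q.coeff 1, hδ, LinearEquiv.ofInjectiveEndo N0 hinj,
    fun x => ⟨by simpa using hco P hP1 (fun j => M j 0) (fun j => (hw j).1) x,
      by simpa using hco Q hQ1 (fun j => M j 1) (fun j => (hw j).2) x⟩⟩

end PolyPart


/-- the rank one symmetric tensor attached to a vector -/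
def sqT {k : Type*} [Field k] (a : Fin 4 → k) : Fin 4 → Fin 4 → k := fun i j => a i * a j

lemma codim_one_helper {k W : Type*} [Field k] [AddCommGroup W] [Module k W]
    [FiniteDimensional k W] (T Y : Submodule k W) (hTY : T ≤ Y)
    (h : Module.finrank k Y ≤ Module.finrank k T + 1) :
    ∃ θ : W, ∀ y ∈ Y, ∃ α : k, y - α • θ ∈ T := by
  by_cases hY : Y ≤ T
  · exact ⟨0, fun y hy => ⟨0, by simpa using hY hy⟩⟩
  · obtain ⟨θ, hθ, hθT⟩ := Set.not_subset.1 hY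
    refine ⟨θ, fun y hy => ?_⟩
    have hle : T ⊔ Submodule.span k {θ} ≤ Y := sup_le hTY (by simpa using hθ)
    have hlt : T < T ⊔ Submodule.span k {θ} := by
      refine lt_of_le_of_ne le_sup_left fun e => hθT ?_
      have : θ ∈ T ⊔ Submodule.span k {θ} :=
        Submodule.mem_sup_right (Submodule.mem_span_singleton_self θ)
      rwa [← e] at this
    have h1 := Submodule.finrank_lt_finrank_of_lt hlt
    have h2 : T ⊔ Submodule.span k {θ} = Y :=
      Submodule.eq_of_le_of_finrank_le hle (by omega)
    rw [← h2] at hy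
    obtain ⟨t, ht, z, hz, rfl⟩ := Submodule.mem_sup.1 hy
    obtain ⟨α, rfl⟩ := Submodule.mem_span_singleton.1 hz
    exact ⟨α, by simpa using ht⟩

lemma p3_core {k ι' : Type*} [Field k] [IsAlgClosed k] [Fintype ι'] [DecidableEq ι'] [Nonempty ι']
    (a : ι' → Fin 4 → k) (hcard : Fintype.card ι' ≤ 6) (c : ι' → k) (hc : ∀ i, c i ≠ 0)
    (hrel : ∑ i, c i • sqT (a i) = 0)
    (hind : ∀ i₀, LinearIndependent k (fun i : {i // i ≠ i₀} => sqT (a i.1)))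
    (hne : ∀ i, a i ≠ 0) (hprop : ∀ i j, i ≠ j → ∀ x : k, a i ≠ x • a j)
    (l : Module.Dual k (Fin 4 → k)) :
    ∃ b, b ≠ 0 ∧ l b = 0 ∧ sqT b ∈ Submodule.span k (Set.range fun i => sqT (a i)) := by
  set U := Submodule.span k (Set.range a) with hU
  set T := Submodule.span k (Set.range fun i => sqT (a i)) with hT
  have haU : ∀ i, a i ∈ U := fun i => Submodule.subset_span ⟨i, rfl⟩
  -- rank bound
  have hd : 2 * Module.finrank k U ≤ Fintype.card ι' := by
    let M : Matrix ι' (Fin 4) k := Matrix.of a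
    have h0 : M.transpose * (Matrix.diagonal c * M) = 0 := by
      ext i j
      have := congrFun (congrFun hrel i) j
      simp [sqT] at this
      rw [Matrix.mul_apply]
      simp [M, Matrix.diagonal_mul]
      rw [← this]
      exact Finset.sum_congr rfl fun x _ => by ring
    have h1 := Matrix.rank_add_rank_le_card_of_mul_eq_zero h0
    rw [Matrix.rank_transpose, Matrix.rank_mul_eq_right_of_isUnit_det _ _
      (by rw [Matrix.det_diagonal, isUnit_iff_ne_zero]
          exact Finset.prod_ne_zero_iff.2 fun i _ => hc i)] at h1
    rw [Matrix.rank_eq_finrank_span_row] at h1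
    have h2 : Submodule.span k (Set.range M.row) = U := rfl
    rw [h2] at h1
    omega
  obtain ⟨i₀⟩ := ‹Nonempty ι'›
  have hTr : Fintype.card ι' ≤ Module.finrank k T + 1 := by
    have h1 : LinearIndependent k
        (fun i : {i // i ≠ i₀} => (⟨sqT (a i.1), Submodule.subset_span ⟨i.1, rfl⟩⟩ : T)) :=
      LinearIndependent.of_comp T.subtype (by simpa [Function.comp_def] using hind i₀)
    have h2 := h1.fintype_card_le_finrank
    rw [Fintype.card_subtype_compl] at h2
    simp at h2
    omega
  -- kernel
  let K := LinearMap.ker (l.domRestrict U)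
  have hK : Module.finrank k U ≤ Module.finrank k K + 1 := by
    have h1 := LinearMap.finrank_range_add_finrank_ker (l.domRestrict U)
    have h2 := Submodule.finrank_le (LinearMap.range (l.domRestrict U))
    simp at h2
    simp only [K]
    omega
  have hd' : Module.finrank k U = 0 ∨ Module.finrank k U = 1 ∨ Module.finrank k U = 2 ∨
    Module.finrank k U = 3 := by omega
  have e := Module.finBasis k U
  rcases hd' with h | h | h | h
  · have : U = ⊥ := Submodule.finrank_eq_zero.1 h
    exact absurd (by simpa [this] using haU i₀) (hne i₀)
  · exfalso
    have : 1 < Fintype.card ι' := by omega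
    obtain ⟨i, j, hij⟩ := Fintype.one_lt_card_iff.1 this
    obtain ⟨⟨u, hu⟩, -, hu2⟩ := finrank_eq_one_iff'.1 h
    obtain ⟨x, hx⟩ := hu2 ⟨a i, haU i⟩
    obtain ⟨y, hy⟩ := hu2 ⟨a j, haU j⟩
    have hx' : x • u = a i := congrArg Subtype.val hx
    have hy' : y • u = a j := congrArg Subtype.val hy
    have hy0 : y ≠ 0 := by rintro rfl; simp at hy'; exact hne j hy'.symm
    refine hprop i j hij (x / y) ?_
    rw [← hx', ← hy', smul_smul, div_mul_cancel₀ _ hy0]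
  · rw [h] at e
    let w : Fin 3 → Fin 4 → Fin 4 → k := ![sqT (e 0 : Fin 4 → k), sqT (e 1 : Fin 4 → k),
      fun i j => (e 0 : Fin 4 → k) i * (e 1 : Fin 4 → k) j + (e 1 : Fin 4 → k) i * (e 0 : Fin 4 → k) j]
    let Y := Submodule.span k (Set.range w)
    have hw : ∀ i, w i ∈ Y := fun i => Submodule.subset_span ⟨i, rfl⟩
    have hY : Module.finrank k Y ≤ 3 := (finrank_range_le_card (R := k) w).trans (by simp)
    have hUY : ∀ u ∈ U, sqT u ∈ Y := by
      intro u hu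
      have h1 := congrArg Subtype.val (e.sum_repr ⟨u, hu⟩)
      simp only [Fin.sum_univ_two, Submodule.coe_add, Submodule.coe_smul] at h1
      have : sqT u = (e.repr ⟨u, hu⟩ 0 * e.repr ⟨u, hu⟩ 0) • w 0 +
          (e.repr ⟨u, hu⟩ 1 * e.repr ⟨u, hu⟩ 1) • w 1 +
          (e.repr ⟨u, hu⟩ 0 * e.repr ⟨u, hu⟩ 1) • w 2 := by
        generalize e.repr ⟨u, hu⟩ = f at *
        rw [← h1]
        ext i j
        simp [w, sqT]
        ring
      rw [this]
      exact Y.add_mem (Y.add_mem (Y.smul_mem _ (hw 0)) (Y.smul_mem _ (hw 1))) (Y.smul_mem _ (hw 2))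
    have hTY : T ≤ Y := Submodule.span_le.2 (by rintro _ ⟨i, rfl⟩; exact hUY _ (haU i))
    have hTe : T = Y := Submodule.eq_of_le_of_finrank_le hTY (by omega)
    have : Nontrivial K := Module.nontrivial_of_finrank_pos (R := k) (by omega)
    obtain ⟨b, hb⟩ := exists_ne (0 : K)
    refine ⟨b.1.1, fun h0 => hb (Subtype.ext (Subtype.ext h0)), b.2, ?_⟩
    rw [hTe]
    exact hUY _ b.1.2
  · rw [h] at e
    let w : Fin 6 → Fin 4 → Fin 4 → k := ![sqT (e 0 : Fin 4 → k), sqT (e 1 : Fin 4 → k),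
      sqT (e 2 : Fin 4 → k),
      fun i j => (e 0 : Fin 4 → k) i * (e 1 : Fin 4 → k) j + (e 1 : Fin 4 → k) i * (e 0 : Fin 4 → k) j,
      fun i j => (e 0 : Fin 4 → k) i * (e 2 : Fin 4 → k) j + (e 2 : Fin 4 → k) i * (e 0 : Fin 4 → k) j,
      fun i j => (e 1 : Fin 4 → k) i * (e 2 : Fin 4 → k) j + (e 2 : Fin 4 → k) i * (e 1 : Fin 4 → k) j]
    let Y := Submodule.span k (Set.range w)
    have hw : ∀ i, w i ∈ Y := fun i => Submodule.subset_span ⟨i, rfl⟩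
    have hY : Module.finrank k Y ≤ 6 := (finrank_range_le_card (R := k) w).trans (by simp)
    have hUY : ∀ u ∈ U, sqT u ∈ Y := by
      intro u hu
      have h1 := congrArg Subtype.val (e.sum_repr ⟨u, hu⟩)
      simp only [Fin.sum_univ_three, Submodule.coe_add, Submodule.coe_smul] at h1
      have : sqT u = (e.repr ⟨u, hu⟩ 0 * e.repr ⟨u, hu⟩ 0) • w 0 +
          (e.repr ⟨u, hu⟩ 1 * e.repr ⟨u, hu⟩ 1) • w 1 +
          (e.repr ⟨u, hu⟩ 2 * e.repr ⟨u, hu⟩ 2) • w 2 +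
          (e.repr ⟨u, hu⟩ 0 * e.repr ⟨u, hu⟩ 1) • w 3 +
          (e.repr ⟨u, hu⟩ 0 * e.repr ⟨u, hu⟩ 2) • w 4 +
          (e.repr ⟨u, hu⟩ 1 * e.repr ⟨u, hu⟩ 2) • w 5 := by
        generalize e.repr ⟨u, hu⟩ = f at *
        rw [← h1]
        ext i j
        simp [w, sqT]
        ring
      rw [this]
      exact Y.add_mem (Y.add_mem (Y.add_mem (Y.add_mem (Y.add_mem (Y.smul_mem _ (hw 0))
        (Y.smul_mem _ (hw 1))) (Y.smul_mem _ (hw 2))) (Y.smul_mem _ (hw 3)))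
        (Y.smul_mem _ (hw 4))) (Y.smul_mem _ (hw 5))
    have hTY : T ≤ Y := Submodule.span_le.2 (by rintro _ ⟨i, rfl⟩; exact hUY _ (haU i))
    obtain ⟨θ, hθ⟩ := codim_one_helper T Y hTY (by omega)
    have : Nontrivial K := Module.nontrivial_of_finrank_pos (R := k) (by omega)
    obtain ⟨b₀, hb₀⟩ := exists_ne (0 : K)
    obtain ⟨b₁, hb₁⟩ := exists_linearIndependent_pair_of_one_lt_finrank (R := k) (M := K)
      (by omega) hb₀
    replace hb₁ := LinearIndependent.pair_iff.1 hb₁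
    obtain ⟨α, hα⟩ := hθ _ (hUY _ b₀.1.2)
    obtain ⟨β, hβ⟩ := hθ _ (hUY _ b₁.1.2)
    obtain ⟨γ, hγ⟩ := hθ _ (hUY _ (b₀ + b₁).1.2)
    obtain ⟨s, t, hst, h0⟩ := exists_binary_zero α (γ - α - β) β
    refine ⟨(s • b₀ + t • b₁).1.1, fun h0 => ?_, (s • b₀ + t • b₁).2, ?_⟩
    · have := hb₁ s t (Subtype.ext (Subtype.ext h0))
      rcases hst with h | h
      · exact h this.1
      · exact h this.2
    · have : sqT (s • b₀ + t • b₁).1.1 = s ^ 2 • (sqT b₀.1.1 - α • θ) +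
          (s * t) • ((sqT (b₀ + b₁).1.1 - γ • θ) - (sqT b₀.1.1 - α • θ) - (sqT b₁.1.1 - β • θ))
          + t ^ 2 • (sqT b₁.1.1 - β • θ) := by
        ext i j
        simp [sqT]
        linear_combination θ i j * h0
      rw [this]
      exact T.add_mem (T.add_mem (T.smul_mem _ hα) (T.smul_mem _ (T.sub_mem (T.sub_mem hγ hα) hβ)))
        (T.smul_mem _ hβ)

lemma p3_lemma {k : Type*} [Field k] [IsAlgClosed k] {r : ℕ} (hr : r ≤ 6)
    (a : Fin r → Fin 4 → k) (hdep : ¬ LinearIndependent k (fun s => sqT (a s)))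
    (hne : ∀ i, a i ≠ 0) (hprop : ∀ i j, i ≠ j → ∀ x : k, a i ≠ x • a j)
    (l : Module.Dual k (Fin 4 → k)) :
    ∃ b, b ≠ 0 ∧ l b = 0 ∧ sqT b ∈ Submodule.span k (Set.range fun i => sqT (a i)) := by
  obtain ⟨S, hS, hmin⟩ := exists_minimal_of_wellFoundedLT
    (fun S : Finset (Fin r) => ¬ LinearIndepOn k (fun s => sqT (a s)) (S : Set (Fin r)))
    ⟨Finset.univ, by simpa [linearIndepOn_univ_iff] using hdep⟩
  have hS' := hS
  rw [linearIndepOn_finset_iff] at hS'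
  push Not at hS'
  obtain ⟨c, hc, i₀, hi₀, hci₀⟩ := hS'
  have herase : ∀ i ∈ S, LinearIndepOn k (fun s => sqT (a s)) (S.erase i : Set (Fin r)) := by
    intro i hi
    by_contra h
    have := hmin (y := S.erase i) (by simpa using h) (Finset.erase_subset _ _)
    exact Finset.notMem_erase i S (this hi)
  have hcne : ∀ i ∈ S, c i ≠ 0 := by
    intro i hi h0
    have h1 := (linearIndepOn_finset_iff (s := S.erase i)).1 (herase i hi) c
      (by rw [← hc]; exact Finset.sum_erase _ (by simp [h0]))
    by_cases e : i₀ = i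
    · exact hci₀ (e ▸ h0)
    · exact hci₀ (h1 i₀ (Finset.mem_erase.2 ⟨e, hi₀⟩))
  have : Nonempty S := ⟨⟨i₀, hi₀⟩⟩
  obtain ⟨b, hb, hlb, hbs⟩ := p3_core (fun i : S => a i)
    (by have := Finset.card_le_univ S; simp at this ⊢; omega) (fun i => c i)
    (fun i => hcne i i.2)
    (by rw [← hc]; exact Finset.sum_coe_sort S (fun i => c i • sqT (a i)))
    (fun i => by
      have := herase i i.2
      rw [LinearIndepOn] at this
      exact this.comp (fun j : {j : S // j ≠ i} => ⟨j.1.1, by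
        simp [Subtype.coe_injective.ne j.2]⟩) (fun x y h => by
          simp at h; exact Subtype.ext h))
    (fun i => hne i) (fun i j h => hprop i j (fun h' => h (Subtype.ext h'))) l
  refine ⟨b, hb, hlb, Submodule.span_mono ?_ hbs⟩
  rintro _ ⟨i, rfl⟩
  exact ⟨i, rfl⟩


/-- multiplication of a binary cubic by the first variable -/
def SA (k : Type*) [Field k] : (Fin 4 → k) →ₗ[k] (Fin 5 → k) where
  toFun a := ![a 0, a 1, a 2, a 3, 0]
  map_add' a b := by ext i; fin_cases i <;> simp
  map_smul' c a := by ext i; fin_cases i <;> simp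

/-- multiplication of a binary cubic by the second variable -/
def TA (k : Type*) [Field k] : (Fin 4 → k) →ₗ[k] (Fin 5 → k) where
  toFun a := ![0, a 0, a 1, a 2, a 3]
  map_add' a b := by ext i; fin_cases i <;> simp
  map_smul' c a := by ext i; fin_cases i <;> simp

/-- multiplication by the first variable, scroll version -/
def SB (k : Type*) [Field k] : (Fin 3 → k) →ₗ[k] (Fin 5 → k) where
  toFun a := ![a 0, 0, a 1, a 2, 0]
  map_add' a b := by ext i; fin_cases i <;> simp
  map_smul' c a := by ext i; fin_cases i <;> simp

/-- multiplication by the second variable, scroll version -/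
def TB (k : Type*) [Field k] : (Fin 3 → k) →ₗ[k] (Fin 5 → k) where
  toFun a := ![0, a 0, 0, a 1, a 2]
  map_add' a b := by ext i; fin_cases i <;> simp
  map_smul' c a := by ext i; fin_cases i <;> simp

lemma cone_lemma {k : Type*} [Field k] [IsAlgClosed k] {n : ℕ}
    (v : Fin n → (Fin 5 → k) × (Fin 5 → k)) (κ : (Fin 5 → k) ≃ₗ[k] (Fin 5 → k))
    (S T : (Fin n → k) →ₗ[k] (Fin 5 → k)) (p0 p1 q0 q1 : k) (hδ : p0 * q1 - p1 * q0 ≠ 0)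
    (N : (Fin n → k) ≃ₗ[k] (Fin n → k))
    (h1 : ∀ x : Fin n → k, ∑ j, x j • κ (v j).1 = p0 • S (N x) + p1 • T (N x))
    (h2 : ∀ x : Fin n → k, ∑ j, x j • κ (v j).2 = q0 • S (N x) + q1 • T (N x))
    (ω : ExteriorAlgebra k (Fin 5 → k)) :
    ω ∈ coneZ (Submodule.span k (Set.range v)) ↔
      ∃ a, ω = ι k (κ.symm (S a)) * ι k (κ.symm (T a)) := by
  obtain ⟨z, hz⟩ := exists_sqrt (p0 * q1 - p1 * q0)
  have hz0 : z ≠ 0 := by rintro rfl; simp at hz; exact hδ hz.symm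
  have key : ∀ x : Fin n → k, ι k (∑ j, x j • v j).1 * ι k (∑ j, x j • v j).2 =
      (p0 * q1 - p1 * q0) • (ι k (κ.symm (S (N x))) * ι k (κ.symm (T (N x)))) := by
    intro x
    have e1 : (∑ j, x j • v j).1 = κ.symm (p0 • S (N x) + p1 • T (N x)) := by
      rw [← h1, LinearEquiv.eq_symm_apply]
      simp [Prod.fst_sum]
    have e2 : (∑ j, x j • v j).2 = κ.symm (q0 • S (N x) + q1 • T (N x)) := by
      rw [← h2, LinearEquiv.eq_symm_apply]
      simp [Prod.snd_sum]
    rw [e1, e2]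
    simp only [map_add, map_smul, add_mul, mul_add, smul_mul_smul_comm, ι_sq_zero]
    rw [eq_neg_of_add_eq_zero_left (ι_add_mul_swap (κ.symm (T (N x))) (κ.symm (S (N x))))]
    module
  constructor
  · rintro ⟨p, hp, rfl⟩
    obtain ⟨x, rfl⟩ := (Submodule.mem_span_range_iff_exists_fun k).1 hp
    refine ⟨z • N x, ?_⟩
    rw [key, ← hz]
    simp only [map_smul, smul_mul_smul_comm]
  · rintro ⟨a, rfl⟩
    refine ⟨∑ j, (N.symm (z⁻¹ • a)) j • v j,
      (Submodule.mem_span_range_iff_exists_fun k).2 ⟨_, rfl⟩, ?_⟩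
    rw [key, ← hz]
    simp only [LinearEquiv.apply_symm_apply, map_smul, smul_mul_smul_comm, smul_smul]
    have : z * z * (z⁻¹ * z⁻¹) = 1 := by field_simp
    rw [this, one_smul]

lemma hM_helper {k : Type*} [Field k] {m n : ℕ} (A : Matrix (Fin m) (Fin n) (Fin 5 → k))
    (g κ : (Fin 5 → k) ≃ₗ[k] (Fin 5 → k)) (C : Set (Fin 5 → k))
    (hg : rankOneLocus A ∪ {0} = g '' C)
    (hκ : ∀ y v, ∑ l, g y l * v l = ∑ n, y n * κ v n) (y : Fin 5 → k) :
    ((Matrix.of fun i j => ∑ n, y n * κ (A i j) n).rank = 1 ∨ y = 0) ↔ y ∈ C := by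
  have h1 : g y ∈ rankOneLocus A ∪ {0} ↔ y ∈ C := by
    rw [hg]; exact g.injective.mem_set_image
  rw [← h1]
  simp only [rankOneLocus, Set.mem_union, Set.mem_ofPred_eq, Set.mem_singleton_iff, hκ]
  simp

lemma hind_helper {k : Type*} [Field k] {n : ℕ} (v : Fin n → (Fin 5 → k) × (Fin 5 → k))
    (κ : (Fin 5 → k) ≃ₗ[k] (Fin 5 → k))
    (h : Module.finrank k (Submodule.span k (Set.range v)) = n) :
    LinearIndependent k (fun j => (κ (v j).1, κ (v j).2)) := by
  have h1 : LinearIndependent k v := by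
    rw [linearIndependent_iff_card_eq_finrank_span, Set.finrank, h]; simp
  let L : ((Fin 5 → k) × (Fin 5 → k)) →ₗ[k] ((Fin 5 → k) × (Fin 5 → k)) :=
    LinearMap.prodMap κ.toLinearMap κ.toLinearMap
  have hL : LinearMap.ker L = ⊥ := by
    rw [LinearMap.ker_eq_bot']
    rintro ⟨x, y⟩ hxy
    have e1 := congrArg Prod.fst hxy
    have e2 := congrArg Prod.snd hxy
    simp [L] at e1 e2
    rw [e1, e2]; rfl
  exact LinearIndependent.map' h1 L hL

lemma dataA {k : Type*} [Field k] [IsAlgClosed k] (A₁ : Matrix (Fin 2) (Fin 4) (Fin 5 → k))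
    (hCA : IsRNQuartic A₁) (hVA : Module.finrank k (colSpace A₁) = 4) :
    ∃ g κ : (Fin 5 → k) ≃ₗ[k] (Fin 5 → k), rankOneLocus A₁ ∪ {0} = g '' coneQuartic k ∧
      (∀ y v, ∑ l, g y l * v l = ∑ n, y n * κ v n) ∧
      ∀ ω, ω ∈ coneZ (colSpace A₁) ↔
        ∃ a, ω = ι k (κ.symm (SA k a)) * ι k (κ.symm (TA k a)) := by
  obtain ⟨g, hg⟩ := hCA
  obtain ⟨κ, hκ⟩ := exists_kappa g
  have : Infinite k := IsAlgClosed.instInfinite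
  obtain ⟨p0, p1, q0, q1, hδ, N, hN⟩ := normalA (fun i j => κ (A₁ i j))
    (hM_helper A₁ g κ _ hg hκ) (hind_helper (fun j => (A₁ 0 j, A₁ 1 j)) κ hVA)
  exact ⟨g, κ, hg, hκ, cone_lemma _ κ (SA k) (TA k) p0 p1 q0 q1 hδ N
    (fun x => (hN x).1) (fun x => (hN x).2)⟩

lemma dataB {k : Type*} [Field k] [IsAlgClosed k] (B₁ : Matrix (Fin 3) (Fin 2) (Fin 5 → k))
    (hSB : IsCubicScroll B₁) (hVB : Module.finrank k (rowSpace B₁) = 3) :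
    ∃ g κ : (Fin 5 → k) ≃ₗ[k] (Fin 5 → k), rankOneLocus B₁ ∪ {0} = g '' coneScroll k ∧
      (∀ y v, ∑ l, g y l * v l = ∑ n, y n * κ v n) ∧
      ∀ ω, ω ∈ coneZ (rowSpace B₁) ↔
        ∃ a, ω = ι k (κ.symm (SB k a)) * ι k (κ.symm (TB k a)) := by
  obtain ⟨g, hg⟩ := hSB
  obtain ⟨κ, hκ⟩ := exists_kappa g
  have : Infinite k := IsAlgClosed.instInfinite
  obtain ⟨p0, p1, q0, q1, hδ, N, hN⟩ := normalB (fun i j => κ (B₁ i j))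
    (hM_helper B₁ g κ _ hg hκ) (hind_helper (fun j => (B₁ j 0, B₁ j 1)) κ hVB)
  exact ⟨g, κ, hg, hκ, cone_lemma _ κ (SB k) (TB k) p0 p1 q0 q1 hδ N
    (fun x => (hN x).1) (fun x => (hN x).2)⟩

lemma hno_lemma {k : Type*} [Field k] (A₁ : Matrix (Fin 2) (Fin 4) (Fin 5 → k))
    (B₁ : Matrix (Fin 3) (Fin 2) (Fin 5 → k))
    (hdisj : rankOneLocus A₁ ∩ rankOneLocus B₁ = ∅)
    (gA κA gB κB : (Fin 5 → k) ≃ₗ[k] (Fin 5 → k))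
    (hgA : rankOneLocus A₁ ∪ {0} = gA '' coneQuartic k)
    (hκA : ∀ y v, ∑ l, gA y l * v l = ∑ n, y n * κA v n)
    (hgB : rankOneLocus B₁ ∪ {0} = gB '' coneScroll k)
    (hκB : ∀ y v, ∑ l, gB y l * v l = ∑ n, y n * κB v n)
    (s t : k) (hst : s ≠ 0 ∨ t ≠ 0)
    (h : ∀ y : Fin 5 → k, κB (κA.symm y) 0 = 0 → κB (κA.symm y) 1 = 0 →
      y 0 * s ^ 4 + y 1 * (s ^ 3 * t) + y 2 * (s ^ 2 * t ^ 2) + y 3 * (s * t ^ 3) + y 4 * t ^ 4 = 0) :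
    False := by
  set q : Fin 5 → k := ![s ^ 4, s ^ 3 * t, s ^ 2 * t ^ 2, s * t ^ 3, t ^ 4] with hq
  have hq0 : q ≠ 0 := by
    intro h0
    have e0 := congrFun h0 0
    have e4 := congrFun h0 4
    simp [q] at e0 e4
    rcases hst with h | h
    · exact h e0
    · exact h e4
  have hφ0 : gA q ≠ 0 := by simpa using hq0
  have hφA : gA q ∈ rankOneLocus A₁ := by
    have : gA q ∈ rankOneLocus A₁ ∪ {0} := by
      rw [hgA]; exact ⟨q, ⟨s, t, rfl⟩, rfl⟩
    rcases this with h | h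
    · exact h
    · exact absurd h hφ0
  set y := gB.symm (gA q) with hy
  have hyv : ∀ v, ∑ n, y n * κB v n = ∑ n, q n * κA v n := by
    intro v
    rw [← hκB, ← hκA, hy, LinearEquiv.apply_symm_apply]
  have h3 : ∀ b0 b1 b2 : k, y 2 * b0 + y 3 * b1 + y 4 * b2 = 0 := by
    intro b0 b1 b2
    have h1 := hyv (κB.symm ![0, 0, b0, b1, b2])
    have h2 := h (κA (κB.symm ![0, 0, b0, b1, b2])) (by simp) (by simp)
    simp only [LinearEquiv.apply_symm_apply, Fin.sum_univ_five] at h1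
    simp [q] at h1
    linear_combination h1 + h2
  have hy2 : y 2 = 0 := by simpa using h3 1 0 0
  have hy3 : y 3 = 0 := by simpa using h3 0 1 0
  have hy4 : y 4 = 0 := by simpa using h3 0 0 1
  have hφB : gA q ∈ rankOneLocus B₁ := by
    have : gA q ∈ rankOneLocus B₁ ∪ {0} := by
      rw [hgB]
      refine ⟨y, ⟨1, 0, y 0, y 1, ?_⟩, by simp [hy]⟩
      ext i
      fin_cases i <;> simp [hy2, hy3, hy4]
    rcases this with h | h
    · exact h
    · exact absurd h hφ0
  exact (Set.eq_empty_iff_forall_notMem.1 hdisj (gA q)) ⟨hφA, hφB⟩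

lemma dep4 {k : Type*} [Field k] (G : (Fin 5 → k) ≃ₗ[k] (Fin 5 → k)) (w : Fin 4 → Fin 5 → k)
    (hw : ∀ i, G (w i) 0 = 0 ∧ G (w i) 1 = 0) :
    ∃ c : Fin 4 → k, ∑ i, c i • w i = 0 ∧ ∃ i, c i ≠ 0 := by
  apply Fintype.not_linearIndependent_iff.1
  intro hli
  let J : (Fin 3 → k) →ₗ[k] (Fin 5 → k) :=
    { toFun := fun b => ![0, 0, b 0, b 1, b 2]
      map_add' := fun a b => by ext i; fin_cases i <;> simp
      map_smul' := fun c a => by ext i; fin_cases i <;> simp }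
  have := card_le_of_range w hli (G.symm.toLinearMap ∘ₗ J) (fun j => by
    refine ⟨![G (w j) 2, G (w j) 3, G (w j) 4], ?_⟩
    simp only [LinearMap.comp_apply, LinearEquiv.coe_coe, LinearEquiv.symm_apply_eq]
    ext i
    fin_cases i <;> simp [J, (hw j).1, (hw j).2])
  omega

lemma lin_cubic_zero {k : Type*} [Field k] (l0 l1 : k) (hl : l0 ≠ 0 ∨ l1 ≠ 0) (a : Fin 4 → k)
    (h0 : l0 * a 0 = 0) (h1 : l0 * a 1 + l1 * a 0 = 0) (h2 : l0 * a 2 + l1 * a 1 = 0)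
    (h3 : l0 * a 3 + l1 * a 2 = 0) (h4 : l1 * a 3 = 0) : a = 0 := by
  rcases eq_or_ne l0 0 with rfl | h
  · have hl1 : l1 ≠ 0 := by simpa using hl
    simp [hl1] at h1 h2 h3 h4
    ext i; fin_cases i <;> simp [*]
  · have e0 : a 0 = 0 := by simpa [h] using h0
    have e1 : a 1 = 0 := by simpa [h, e0] using h1
    have e2 : a 2 = 0 := by simpa [h, e1] using h2
    have e3 : a 3 = 0 := by simpa [h, e2] using h3
    ext i; fin_cases i <;> simp [*]

lemma quad_quad_zero {k : Type*} [Field k] (c0 c1 c2 : k) (hc : ¬ (c0 = 0 ∧ c1 = 0 ∧ c2 = 0))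
    (d0 d1 d2 : k) (h0 : d0 * c0 = 0) (h1 : d0 * c1 + d1 * c0 = 0)
    (h2 : d0 * c2 + d1 * c1 + d2 * c0 = 0) (h3 : d1 * c2 + d2 * c1 = 0) (h4 : d2 * c2 = 0) :
    d0 = 0 ∧ d1 = 0 ∧ d2 = 0 := by
  rcases eq_or_ne c0 0 with rfl | h
  · rcases eq_or_ne c1 0 with rfl | h'
    · have : c2 ≠ 0 := by simpa using hc
      simp [this] at h2 h3 h4
      exact ⟨h2, h3, h4⟩
    · have e0 : d0 = 0 := by simpa [h'] using h1
      have e1 : d1 = 0 := by simpa [h', e0] using h2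
      have e2 : d2 = 0 := by simpa [h', e1] using h3
      exact ⟨e0, e1, e2⟩
  · have e0 : d0 = 0 := by simpa [h] using h0
    have e1 : d1 = 0 := by simpa [h, e0] using h1
    have e2 : d2 = 0 := by simpa [h, e1, e0] using h2
    exact ⟨e0, e1, e2⟩

lemma fact_a {k : Type*} [Field k] [IsAlgClosed k] (G : (Fin 5 → k) ≃ₗ[k] (Fin 5 → k))
    (hno : ∀ s t : k, (s ≠ 0 ∨ t ≠ 0) → ¬ ∀ y : Fin 5 → k, G y 0 = 0 → G y 1 = 0 →
      y 0 * s ^ 4 + y 1 * (s ^ 3 * t) + y 2 * (s ^ 2 * t ^ 2) + y 3 * (s * t ^ 3) + y 4 * t ^ 4 = 0)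
    (a b : Fin 4 → k) (ha : a ≠ 0) (hb : b ≠ 0)
    (h1 : G (SA k a) 0 = 0 ∧ G (SA k a) 1 = 0) (h2 : G (TA k a) 0 = 0 ∧ G (TA k a) 1 = 0)
    (h3 : G (SA k b) 0 = 0 ∧ G (SA k b) 1 = 0) (h4 : G (TA k b) 0 = 0 ∧ G (TA k b) 1 = 0) :
    ∃ x : k, b = x • a := by
  obtain ⟨g, hg, hg0⟩ := dep4 G ![SA k a, TA k a, SA k b, TA k b] (by
    intro i; fin_cases i
    · exact h1
    · exact h2
    · exact h3
    · exact h4)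
  obtain ⟨l0, hl0⟩ : ∃ l0, l0 = g 0 := ⟨_, rfl⟩
  obtain ⟨l1, hl1⟩ : ∃ l1, l1 = g 1 := ⟨_, rfl⟩
  obtain ⟨m0, hm0⟩ : ∃ m0, m0 = -g 2 := ⟨_, rfl⟩
  obtain ⟨m1, hm1⟩ : ∃ m1, m1 = -g 3 := ⟨_, rfl⟩
  have r0 : l0 * a 0 = m0 * b 0 := by
    have := congrFun hg 0
    simp [Fin.sum_univ_four, SA, TA] at this
    rw [hl0, hm0]; linear_combination this
  have r1 : l0 * a 1 + l1 * a 0 = m0 * b 1 + m1 * b 0 := by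
    have := congrFun hg 1
    simp [Fin.sum_univ_four, SA, TA] at this
    rw [hl0, hm0, hl1, hm1]; linear_combination this
  have r2 : l0 * a 2 + l1 * a 1 = m0 * b 2 + m1 * b 1 := by
    have := congrFun hg 2
    simp [Fin.sum_univ_four, SA, TA] at this
    rw [hl0, hm0, hl1, hm1]; linear_combination this
  have r3 : l0 * a 3 + l1 * a 2 = m0 * b 3 + m1 * b 2 := by
    have := congrFun hg 3
    simp [Fin.sum_univ_four, SA, TA] at this
    rw [hl0, hm0, hl1, hm1]; linear_combination this
  have r4 : l1 * a 3 = m1 * b 3 := by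
    have := congrFun hg 4
    simp [Fin.sum_univ_four, SA, TA] at this
    rw [hl1, hm1]; linear_combination this
  have hnz : (l0 ≠ 0 ∨ l1 ≠ 0) ∨ (m0 ≠ 0 ∨ m1 ≠ 0) := by
    obtain ⟨i, hi⟩ := hg0
    fin_cases i
    · exact Or.inl (Or.inl (by rw [hl0]; exact hi))
    · exact Or.inl (Or.inr (by rw [hl1]; exact hi))
    · exact Or.inr (Or.inl (by rw [hm0]; exact neg_ne_zero.2 hi))
    · exact Or.inr (Or.inr (by rw [hm1]; exact neg_ne_zero.2 hi))
  clear hl0 hl1 hm0 hm1 hg hg0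
  by_cases hΔ : l0 * m1 - l1 * m0 = 0
  · -- proportional
    have hm : m0 ≠ 0 ∨ m1 ≠ 0 := by
      by_contra hm
      push Not at hm
      obtain ⟨rfl, rfl⟩ := hm
      have hl : l0 ≠ 0 ∨ l1 ≠ 0 := by simpa using hnz
      exact ha (lin_cubic_zero l0 l1 hl a (by simpa using r0) (by simpa using r1)
        (by simpa using r2) (by simpa using r3) (by simpa using r4))
    obtain ⟨x, hx0, hx1⟩ : ∃ x, l0 = x * m0 ∧ l1 = x * m1 := by
      rcases hm with h | h
      · exact ⟨l0 / m0, by field_simp, by field_simp; linear_combination -hΔ⟩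
      · exact ⟨l1 / m1, by field_simp; linear_combination hΔ, by field_simp⟩
    refine ⟨x, ?_⟩
    rw [← sub_eq_zero]
    subst hx0 hx1
    apply lin_cubic_zero m0 m1 hm
    · show m0 * (b 0 - x * a 0) = 0
      linear_combination -r0
    · simp; linear_combination -r1
    · simp; linear_combination -r2
    · simp; linear_combination -r3
    · show m1 * (b 3 - x * a 3) = 0
      linear_combination -r4
  · exfalso
    obtain ⟨c0, hc0⟩ : ∃ c, (l0 * m1 - l1 * m0) * c = m1 * b 0 - l1 * a 0 :=
      ⟨(m1 * b 0 - l1 * a 0) / (l0 * m1 - l1 * m0), by field_simp⟩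
    obtain ⟨c1, hc1⟩ : ∃ c, (l0 * m1 - l1 * m0) * c = m1 * b 1 - l1 * a 1 :=
      ⟨(m1 * b 1 - l1 * a 1) / (l0 * m1 - l1 * m0), by field_simp⟩
    obtain ⟨c2, hc2⟩ : ∃ c, (l0 * m1 - l1 * m0) * c = m1 * b 2 - l1 * a 2 :=
      ⟨(m1 * b 2 - l1 * a 2) / (l0 * m1 - l1 * m0), by field_simp⟩
    set Δ := l0 * m1 - l1 * m0 with hΔd
    have X0 : ![c0, c1, c2, 0, 0] = Δ⁻¹ • (m1 • SA k b - l1 • SA k a) := by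
      rw [eq_inv_smul_iff₀ hΔ]
      ext i; fin_cases i <;> simp [SA]
      · linear_combination hc0
      · linear_combination hc1
      · linear_combination hc2
      · linear_combination r4
    have X1 : ![0, c0, c1, c2, 0] = Δ⁻¹ • (m1 • TA k b - l1 • TA k a) := by
      rw [eq_inv_smul_iff₀ hΔ]
      ext i; fin_cases i <;> simp [TA]
      · linear_combination hc0
      · linear_combination hc1
      · linear_combination hc2
      · linear_combination r4
    have X2 : ![0, 0, c0, c1, c2] = Δ⁻¹ • (l0 • TA k a - m0 • TA k b) := by
      rw [eq_inv_smul_iff₀ hΔ]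
      ext i; fin_cases i <;> simp [TA]
      · linear_combination -r0
      · linear_combination hc0 - r1
      · linear_combination hc1 - r2
      · linear_combination hc2 - r3
    have hc : ¬ (c0 = 0 ∧ c1 = 0 ∧ c2 = 0) := by
      rintro ⟨rfl, rfl, rfl⟩
      have e1 : m1 • TA k b - l1 • TA k a = 0 := by
        have : (![0, 0, 0, 0, 0] : Fin 5 → k) = 0 := by ext i; fin_cases i <;> simp
        rw [this, eq_comm, smul_eq_zero] at X1
        exact X1.resolve_left (inv_ne_zero hΔ)
      have e2 : l0 • TA k a - m0 • TA k b = 0 := by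
        have : (![0, 0, 0, 0, 0] : Fin 5 → k) = 0 := by ext i; fin_cases i <;> simp
        rw [this, eq_comm, smul_eq_zero] at X2
        exact X2.resolve_left (inv_ne_zero hΔ)
      have e3 : Δ • TA k a = 0 := by
        have : Δ • TA k a = m0 • (m1 • TA k b - l1 • TA k a) + m1 • (l0 • TA k a - m0 • TA k b) := by
          rw [hΔd]; module
        rw [this, e1, e2]; simp
      have e4 := (smul_eq_zero.1 e3).resolve_left hΔ
      apply ha
      ext i
      fin_cases i
      · simpa [TA] using congrFun e4 1
      · simpa [TA] using congrFun e4 2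
      · simpa [TA] using congrFun e4 3
      · simpa [TA] using congrFun e4 4
    obtain ⟨s, t, hst, hz⟩ := exists_binary_zero c0 c1 c2
    refine hno s t hst fun y hy0 hy1 => ?_
    obtain ⟨d, hd, hd0⟩ := dep4 G ![![c0, c1, c2, 0, 0], ![0, c0, c1, c2, 0], ![0, 0, c0, c1, c2], y]
      (by
        intro i; fin_cases i
        · simp [X0, h1, h2, h3, h4]
        · simp [X1, h1, h2, h3, h4]
        · simp [X2, h1, h2, h3, h4]
        · exact ⟨hy0, hy1⟩)
    have k0 := congrFun hd 0
    have k1 := congrFun hd 1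
    have k2 := congrFun hd 2
    have k3 := congrFun hd 3
    have k4 := congrFun hd 4
    simp [Fin.sum_univ_four] at k0 k1 k2 k3 k4
    by_cases h3 : d 3 = 0
    · rw [h3] at k0 k1 k2 k3 k4
      obtain ⟨f0, f1, f2⟩ := quad_quad_zero c0 c1 c2 hc (d 0) (d 1) (d 2) (by simpa using k0)
        (by linear_combination k1) (by linear_combination k2) (by linear_combination k3)
        (by simpa using k4)
      obtain ⟨i, hi⟩ := hd0
      exfalso
      fin_cases i
      · exact hi f0
      · exact hi f1
      · exact hi f2
      · exact hi h3
    · apply mul_left_cancel₀ h3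
      linear_combination s ^ 4 * k0 + s ^ 3 * t * k1 + s ^ 2 * t ^ 2 * k2 + s * t ^ 3 * k3
        + t ^ 4 * k4 - (d 0 * s ^ 2 + d 1 * s * t + d 2 * t ^ 2) * hz

lemma sq_prop {k : Type*} [Field k] (a b : Fin 4 → k) (ha : a ≠ 0) (c : k)
    (h : sqT a = c • sqT b) : ∃ x : k, a = x • b := by
  obtain ⟨i, hi⟩ := Function.ne_iff.1 ha
  simp at hi
  refine ⟨c * b i / a i, ?_⟩
  ext j
  have := congrFun (congrFun h i) j
  simp [sqT] at this
  simp
  field_simp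
  linear_combination this

lemma exists_Lam {k : Type*} [Field k] (E : (Fin 5 → k) ≃ₗ[k] (Fin 5 → k)) :
    ∃ L : (Fin 4 → Fin 4 → k) →ₗ[k] ExteriorAlgebra k (Fin 5 → k),
      ∀ a, L (sqT a) = ι k (E (SA k a)) * ι k (E (TA k a)) := by
  let b1 : Fin 4 → ExteriorAlgebra k (Fin 5 → k) := fun i => ι k (E (SA k (Pi.single i 1)))
  let b2 : Fin 4 → ExteriorAlgebra k (Fin 5 → k) := fun i => ι k (E (TA k (Pi.single i 1)))
  have gen : ∀ (f : (Fin 4 → k) →ₗ[k] ExteriorAlgebra k (Fin 5 → k)) (a : Fin 4 → k),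
      f a = ∑ i, a i • f (Pi.single i 1) := fun f a => by
    conv_lhs => rw [pi_eq_sum_univ' a]
    simp
  refine ⟨{ toFun := fun p => ∑ i, ∑ j, p i j • (b1 i * b2 j)
            map_add' := fun p q => by
              simp [add_smul, Finset.sum_add_distrib]
            map_smul' := fun c p => by
              simp [Finset.smul_sum, smul_smul] }, fun a => ?_⟩
  have e1 := gen (ι k ∘ₗ E.toLinearMap ∘ₗ SA k) a
  have e2 := gen (ι k ∘ₗ E.toLinearMap ∘ₗ TA k) a
  simp only [LinearMap.comp_apply, LinearEquiv.coe_coe] at e1 e2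
  rw [e1, e2, Finset.sum_mul_sum]
  simp only [smul_mul_smul_comm]
  rfl

lemma exists_Psi {k : Type*} [Field k] (E : (Fin 5 → k) ≃ₗ[k] (Fin 5 → k)) :
    ∃ P : ExteriorAlgebra k (Fin 5 → k) →ₗ[k] (Fin 4 → Fin 4 → k),
      ∀ a, P (ι k (E (SA k a)) * ι k (E (TA k a))) = sqT a := by
  have := fun i j : Fin 5 => exists_plucker
    ((LinearMap.proj i : (Fin 5 → k) →ₗ[k] k) ∘ₗ E.symm.toLinearMap)
    ((LinearMap.proj j : (Fin 5 → k) →ₗ[k] k) ∘ₗ E.symm.toLinearMap)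
  choose p hp using this
  simp at hp
  refine ⟨LinearMap.pi fun i => LinearMap.pi fun j =>
    ![![p 0 1, p 0 2, p 0 3, p 0 4], ![p 0 2, p 1 2 + p 0 3, p 1 3 + p 0 4, p 1 4],
      ![p 0 3, p 1 3 + p 0 4, p 2 3 + p 1 4, p 2 4], ![p 0 4, p 1 4, p 2 4, p 3 4]] i j, fun a => ?_⟩
  ext i j
  fin_cases i <;> fin_cases j <;> simp [hp, SA, TA, sqT] <;> ring

lemma fact_c {k : Type*} [Field k] [IsAlgClosed k] (F : (Fin 5 → k) ≃ₗ[k] (Fin 5 → k))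
    (v w : Fin 5 → k)
    (h : ι k (F v) * ι k (F w) ∈ Submodule.span k
      (Set.range fun m => ι k (F (SB k m)) * ι k (F (TB k m)))) :
    (∃ m, ι k (F v) * ι k (F w) = ι k (F (SB k m)) * ι k (F (TB k m))) ∨
      (v 0 = 0 ∧ v 1 = 0) ∧ (w 0 = 0 ∧ w 1 = 0) := by
  have := fun i j : Fin 5 => exists_plucker
    ((LinearMap.proj i : (Fin 5 → k) →ₗ[k] k) ∘ₗ F.symm.toLinearMap)
    ((LinearMap.proj j : (Fin 5 → k) →ₗ[k] k) ∘ₗ F.symm.toLinearMap)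
  choose p hp using this
  simp at hp
  obtain ⟨R, hR⟩ := wedge_expand F.toLinearMap
  simp only [LinearEquiv.coe_coe] at hR
  have kill : ∀ f : ExteriorAlgebra k (Fin 5 → k) →ₗ[k] k,
      (∀ m, f (ι k (F (SB k m)) * ι k (F (TB k m))) = 0) → f (ι k (F v) * ι k (F w)) = 0 := by
    intro f hf
    have : Submodule.span k (Set.range fun m => ι k (F (SB k m)) * ι k (F (TB k m))) ≤
        LinearMap.ker f := Submodule.span_le.2 (by rintro _ ⟨m, rfl⟩; exact hf m)
    exact this h
  have r02 := kill (p 0 2) (fun m => by simp [hp, SB, TB])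
  have r14 := kill (p 1 4) (fun m => by simp [hp, SB, TB])
  have r12 := kill (p 1 2 + p 0 3) (fun m => by simp [hp, SB, TB])
  have r13 := kill (p 1 3 + p 0 4) (fun m => by simp [hp, SB, TB])
  simp only [LinearMap.add_apply, hp, LinearEquiv.symm_apply_apply] at r02 r14 r12 r13
  by_cases hA : v 0 * w 1 - w 0 * v 1 = 0
  · have hD : v 0 * w 3 - w 0 * v 3 = 0 := by
      apply pow_eq_zero_iff (two_ne_zero) |>.1
      linear_combination (v 0 * w 3 - w 0 * v 3) * r12 + (v 2 * w 3 - w 2 * v 3) * hA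
        - (v 1 * w 3 - w 1 * v 3) * r02
    have hE : v 0 * w 4 - w 0 * v 4 = 0 := by
      apply pow_eq_zero_iff (two_ne_zero) |>.1
      linear_combination (v 0 * w 4 - w 0 * v 4) * r13 + (v 3 * w 4 - w 3 * v 4) * hA
        - (v 0 * w 3 - w 0 * v 3) * r14
    by_cases hz : (v 0 = 0 ∧ v 1 = 0) ∧ (w 0 = 0 ∧ w 1 = 0)
    · exact Or.inr hz
    left
    have q0 : ∀ j, v 0 * w j - w 0 * v j = 0 := by
      intro j; fin_cases j
      · show v 0 * w 0 - w 0 * v 0 = 0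
        ring
      · exact hA
      · exact r02
      · exact hD
      · exact hE
    have q1 : ∀ j, v 1 * w j - w 1 * v j = 0 := by
      intro j; fin_cases j
      · show v 1 * w 0 - w 1 * v 0 = 0
        linear_combination -hA
      · show v 1 * w 1 - w 1 * v 1 = 0
        ring
      · show v 1 * w 2 - w 1 * v 2 = 0
        linear_combination r12 - hD
      · show v 1 * w 3 - w 1 * v 3 = 0
        linear_combination r13 - hE
      · exact r14
    have all : ∀ i j, v i * w j - v j * w i = 0 := by
      intro i j
      have hz' : v 0 ≠ 0 ∨ v 1 ≠ 0 ∨ w 0 ≠ 0 ∨ w 1 ≠ 0 := by tauto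
      rcases hz' with h | h | h | h
      · apply (mul_eq_zero.1 _).resolve_left h
        linear_combination v i * q0 j - v j * q0 i
      · apply (mul_eq_zero.1 _).resolve_left h
        linear_combination v i * q1 j - v j * q1 i
      · apply (mul_eq_zero.1 _).resolve_left h
        linear_combination w i * q0 j - w j * q0 i
      · apply (mul_eq_zero.1 _).resolve_left h
        linear_combination w i * q1 j - w j * q1 i
    refine ⟨0, ?_⟩
    rw [hR, hR]
    congr 1
    ext i j
    rw [all]
    simp
  · left
    obtain ⟨α, hα⟩ := exists_sqrt (v 0 * w 1 - w 0 * v 1)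
    have hα0 : α ≠ 0 := by rintro rfl; simp at hα; exact hA hα.symm
    obtain ⟨β, hβ⟩ : ∃ β, α * β = v 0 * w 3 - w 0 * v 3 := ⟨_ / α, mul_div_cancel₀ _ hα0⟩
    obtain ⟨γ, hγ⟩ : ∃ β, α * β = v 0 * w 4 - w 0 * v 4 := ⟨_ / α, mul_div_cancel₀ _ hα0⟩
    have hB : v 2 * w 3 - w 2 * v 3 = β * β := by
      apply mul_left_cancel₀ hA
      linear_combination -(v 0 * w 3 - w 0 * v 3) * r12 + (v 1 * w 3 - w 1 * v 3) * r02
        + β * β * hα - (α * β + (v 0 * w 3 - w 0 * v 3)) * hβ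
    have hF : v 2 * w 4 - w 2 * v 4 = β * γ := by
      apply mul_left_cancel₀ hA
      linear_combination -(v 0 * w 4 - w 0 * v 4) * r12 + (v 1 * w 4 - w 1 * v 4) * r02
        + β * γ * hα - α * γ * hβ - (v 0 * w 3 - w 0 * v 3) * hγ
    have hC : v 3 * w 4 - w 3 * v 4 = γ * γ := by
      apply mul_left_cancel₀ hA
      linear_combination -(v 0 * w 4 - w 0 * v 4) * r13 + (v 0 * w 3 - w 0 * v 3) * r14
        + γ * γ * hα - (α * γ + (v 0 * w 4 - w 0 * v 4)) * hγ
    have alt : ∀ f g : Fin 5 → Fin 5 → k, (∀ i, f i i = 0) → (∀ i, g i i = 0) →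
        (∀ i j, f i j = - f j i) → (∀ i j, g i j = - g j i) → (∀ i j, i < j → f i j = g i j) →
        f = g := by
      intro f g hf hg hf' hg' h
      ext i j
      rcases lt_trichotomy i j with hij | hij | hij
      · exact h i j hij
      · rw [hij, hf, hg]
      · rw [hf', hg', h j i hij]
    refine ⟨![α, β, γ], ?_⟩
    rw [hR, hR]
    congr 1
    apply alt
    · intro i; ring
    · intro i; ring
    · intro i j; ring
    · intro i j; ring
    · intro i j hij
      fin_cases i <;> fin_cases j <;> first
        | (exfalso; revert hij; decide)
        | (simp [SB, TB]; first
            | linear_combination -hα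
            | linear_combination r02
            | linear_combination -hβ
            | linear_combination -hγ
            | linear_combination r12 + hβ
            | linear_combination r13 + hγ
            | linear_combination r14
            | linear_combination hB
            | linear_combination hF
            | linear_combination hC)

/-!
STATEMENT 16: Assume the generality assumption (`C_A` a smooth rational normal quartic,
`S_B` a smooth rational cubic scroll, `C_A ∩ S_B = ∅`, `V_A` of dimension 4, `V_B` of
dimension 3), and suppose `Γ = Z_A ∩ Z_B` is finite, consisting of `r ≤ 6` distinct
points.  Then representative vectors in `⋀²V` of the `r` points are linearly independent.

The representatives are given by a family `ω : Fin r → ⋀V` of nonzero elements of the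
affine cone over `Z_A ∩ Z_B` defining pairwise distinct projective points (hence, since
`Γ` has exactly `r` elements, representing all the `r` points of `Γ`).
-/
theorem stmt16 (k : Type*) [Field k] [IsAlgClosed k]
    (A₁ : Matrix (Fin 2) (Fin 4) (Fin 5 → k)) (B₁ : Matrix (Fin 3) (Fin 2) (Fin 5 → k))
    (hCA : IsRNQuartic A₁) (hSB : IsCubicScroll B₁)
    (hdisj : rankOneLocus A₁ ∩ rankOneLocus B₁ = ∅)
    (hVA : Module.finrank k (colSpace A₁) = 4)
    (hVB : Module.finrank k (rowSpace B₁) = 3)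
    (r : ℕ) (hr : r ≤ 6)
    (hfin : (gammaSet A₁ B₁).Finite) (hcard : (gammaSet A₁ B₁).ncard = r)
    (ω : Fin r → ExteriorAlgebra k (Fin 5 → k))
    (hω : ∀ s, ω s ∈ coneZ (colSpace A₁) ∩ coneZ (rowSpace B₁))
    (hne : ∀ s, ω s ≠ 0)
    (hdistinct : ∀ s t, s ≠ t →
      Projectivization.mk k (ω s) (hne s) ≠ Projectivization.mk k (ω t) (hne t)) :
    LinearIndependent k ω := by
  have : Infinite k := IsAlgClosed.instInfinite
  obtain ⟨gA, κA, hgA, hκA, hA⟩ := dataA A₁ hCA hVA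
  obtain ⟨gB, κB, hgB, hκB, hB⟩ := dataB B₁ hSB hVB
  obtain ⟨L, hL⟩ := exists_Lam κA.symm
  obtain ⟨P, hP⟩ := exists_Psi κA.symm
  let G : (Fin 5 → k) ≃ₗ[k] (Fin 5 → k) := κA.symm.trans κB
  have hno : ∀ s t : k, (s ≠ 0 ∨ t ≠ 0) → ¬ ∀ y : Fin 5 → k, G y 0 = 0 → G y 1 = 0 →
      y 0 * s ^ 4 + y 1 * (s ^ 3 * t) + y 2 * (s ^ 2 * t ^ 2) + y 3 * (s * t ^ 3) + y 4 * t ^ 4 = 0 :=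
    fun s t hst h => hno_lemma A₁ B₁ hdisj gA κA gB κB hgA hκA hgB hκB s t hst h
  choose a ha using fun s => (hA (ω s)).1 (hω s).1
  choose m hm using fun s => (hB (ω s)).1 (hω s).2
  have ha0 : ∀ s, a s ≠ 0 := by
    intro s h
    apply hne s
    rw [ha s, h]; simp
  have hprop : ∀ s t, s ≠ t → ∀ x : k, a s ≠ x • a t := by
    intro s t hst x h
    apply hdistinct s t hst
    rw [Projectivization.mk_eq_mk_iff']
    refine ⟨x * x, ?_⟩
    rw [ha s, ha t, h]
    simp only [map_smul, smul_mul_smul_comm]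
  by_contra hdep
  have hdep' : ¬ LinearIndependent k (fun s => sqT (a s)) := by
    intro h
    apply hdep
    apply LinearIndependent.of_comp P
    convert h using 1
    funext s
    simp [Function.comp, ha s, hP]
  -- representatives of the points
  have hz : ∀ z : gammaSet A₁ B₁, ∃ a, a ≠ 0 ∧
      ∀ (w : ExteriorAlgebra k (Fin 5 → k)) (hw : w ≠ 0), Projectivization.mk k w hw = z.1 →
        ∃ c : k, w = c • (ι k (κA.symm (SA k a)) * ι k (κA.symm (TA k a))) := by
    rintro ⟨z, w, hw, hzw, h1, h2⟩
    obtain ⟨a, rfl⟩ := (hA w).1 h1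
    refine ⟨a, ?_, fun w' hw' h => ?_⟩
    · rintro rfl; simp at hw
    · simp only [hzw] at h
      rw [Projectivization.mk_eq_mk_iff'] at h
      obtain ⟨c, hc⟩ := h
      exact ⟨c, hc.symm⟩
  choose az haz0 haz using hz
  have hex : ∃ a₀ : Fin 4 → k, a₀ ≠ 0 ∧ ∀ b : Fin 4 → k, b ≠ 0 →
      (G (SA k b) 0 = 0 ∧ G (SA k b) 1 = 0) → (G (TA k b) 0 = 0 ∧ G (TA k b) 1 = 0) →
      ∃ x : k, b = x • a₀ := by
    by_cases h : ∃ a₀ : Fin 4 → k, a₀ ≠ 0 ∧ (G (SA k a₀) 0 = 0 ∧ G (SA k a₀) 1 = 0) ∧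
      (G (TA k a₀) 0 = 0 ∧ G (TA k a₀) 1 = 0)
    · obtain ⟨a₀, h0, h1, h2⟩ := h
      exact ⟨a₀, h0, fun b hb h3 h4 => fact_a G hno a₀ b h0 hb h1 h2 h3 h4⟩
    · exact ⟨fun _ => 1, fun h => one_ne_zero (congrFun h 0),
        fun b hb h3 h4 => absurd ⟨b, hb, h3, h4⟩ h⟩
  obtain ⟨a₀, ha₀, hex⟩ := hex
  have : Finite (gammaSet A₁ B₁) := hfin
  obtain ⟨l, hl⟩ := Module.exists_dual_forall_apply_ne_zero (K := k) (M := Fin 4 → k)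
    (fun o : Option (gammaSet A₁ B₁) => o.elim a₀ az)
    (by rintro (_ | z)
        · exact ha₀
        · exact haz0 z)
  obtain ⟨b, hb0, hlb, hb⟩ := p3_lemma hr a hdep' ha0 hprop l
  set w := ι k (κA.symm (SA k b)) * ι k (κA.symm (TA k b)) with hwdef
  have hw0 : w ≠ 0 := by
    intro h
    have h1 := hP b
    rw [← hwdef, h, map_zero] at h1
    obtain ⟨i, hi⟩ := Function.ne_iff.1 hb0
    have := congrFun (congrFun h1 i) i
    simp [sqT] at this
    exact hi this
  have hGG : ∀ y, κB.symm (G y) = κA.symm y := fun y => by simp [G]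
  have hspan : w ∈ Submodule.span k
      (Set.range fun m => ι k (κB.symm (SB k m)) * ι k (κB.symm (TB k m))) := by
    have h1 : w = L (sqT b) := (hL b).symm
    rw [h1]
    have h2 : Submodule.span k (Set.range fun i => sqT (a i)) ≤ (Submodule.span k
        (Set.range fun m => ι k (κB.symm (SB k m)) * ι k (κB.symm (TB k m)))).comap L := by
      rw [Submodule.span_le]
      rintro _ ⟨i, rfl⟩
      refine Submodule.subset_span ⟨m i, ?_⟩
      change _ = L (sqT (a i))
      rw [hL, ← ha, hm]
    exact h2 hb
  rw [hwdef, ← hGG, ← hGG] at hspan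
  rcases fact_c κB.symm _ _ hspan with ⟨m', hm'⟩ | ⟨h1, h2⟩
  · rw [hGG, hGG, ← hwdef] at hm'
    obtain ⟨c, hc⟩ := haz ⟨Projectivization.mk k w hw0, w, hw0, rfl, (hA w).2 ⟨b, rfl⟩,
      (hB w).2 ⟨m', hm'⟩⟩ w hw0 rfl
    set z : gammaSet A₁ B₁ := ⟨Projectivization.mk k w hw0, w, hw0, rfl, (hA w).2 ⟨b, rfl⟩,
      (hB w).2 ⟨m', hm'⟩⟩ with hzdef
    have h3 := congrArg P hc
    rw [map_smul, hP, hP] at h3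
    obtain ⟨x, hx⟩ := sq_prop b _ hb0 c h3
    have hx0 : x ≠ 0 := by rintro rfl; simp at hx; exact hb0 hx
    rw [hx, map_smul, smul_eq_mul] at hlb
    exact hl (some z) ((mul_eq_zero.1 hlb).resolve_left hx0)
  · obtain ⟨x, hx⟩ := hex b hb0 h1 h2
    have hx0 : x ≠ 0 := by rintro rfl; simp at hx; exact hb0 hx
    rw [hx, map_smul, smul_eq_mul] at hlb
    exact hl none ((mul_eq_zero.1 hlb).resolve_left hx0)
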